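/- arXiv:1706.09595 — 3 statements merged into one kernel-verified Lean document; each statement's English description precedes it below -/
import Mathlib

section
/- Let s ∈ GL_n(𝔽_q) be a semisimple ℓ'-element, i.e. the order of s is coprime to both p and ℓ. Let a ≥ 0 be an integer such that ℓ^a divides q − 1 and ℓ^a divides dim_K ker(s − ξ) for every eigenvalue ξ ∈ K of s, and let ω ∈ 𝔽_q^× be an element of multiplicative order ℓ^a. Then there exists an ℓ-element u ∈ GL_n(𝔽_q) commuting with s such that: (1) for every eigenvalue ξ of s, the set of eigenvalues of u on the eigenspace ker(s − ξ) ⊆ K^n equals {ω^i : 0 ≤ i ≤ ℓ^a − 1}, and in particular is independent of ξ; (2) the set of scalars z ∈ 𝔽_q^× of ℓ-power order such that the matrix z·su is conjugate to su in GL_n(𝔽_q) has exactly ℓ^a elements. -/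
open Module

/-- The `K`-linear endomorphism of `K^n` attached to a matrix `g ∈ GL_n(F)`, where `K` is an
extension of `F`: extend scalars entrywise and act on column vectors. -/
noncomputable def glToEnd {n : ℕ} {F K : Type*} [Field F] [Field K] [Algebra F K]
    (g : GL (Fin n) F) : Module.End K (Fin n → K) :=
  Matrix.toLin' ((g : Matrix (Fin n) (Fin n) F).map (algebraMap F K))

/-- The scalar matrix attached to `z ∈ Fˣ`, as an element of `GL_n(F)`. -/
def scalarGL {n : ℕ} {F : Type*} [Field F] (z : Fˣ) : GL (Fin n) F :=
  Units.map (Matrix.scalar (Fin n)).toMonoidHom z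


/-- If the order of a finite group `G` divides the size of every fibre of `f`, then there are a
`G`-valued colouring and a permutation preserving the fibres which multiplies colours by `w`. -/
lemma exists_perm_coloring {ι α G : Type*} [Finite ι] [Group G] [Finite G] (f : ι → α)
    (h : ∀ x, Nat.card G ∣ Nat.card {i // f i = x}) (w : G) :
    ∃ (σ : Equiv.Perm ι) (c : ι → G), ∀ i, f (σ i) = f i ∧ c (σ i) = w * c i := by
  have key (x : α) : ∃ d, Nonempty ({i // f i = x} ≃ Fin d × G) := by
    obtain ⟨d, hd⟩ := h x
    exact ⟨d, Finite.card_eq.mp (by simp [hd, mul_comm])⟩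
  choose d e using key
  let E (x : α) := (e x).some
  let τ : Equiv.Perm (Σ x, {i // f i = x}) := Equiv.sigmaCongrRight fun x ↦
    ((E x).trans ((Equiv.refl _).prodCongr (Equiv.mulLeft w))).trans (E x).symm
  let c' : (Σ x, {i // f i = x}) → G := fun y ↦ (E y.1 y.2).2
  let S := Equiv.sigmaFiberEquiv f
  have hS (y) : f (S y) = y.1 := y.2.2
  refine ⟨(S.symm.trans τ).trans S, fun i ↦ c' (S.symm i), fun i ↦ ?_⟩
  obtain ⟨y, rfl⟩ := S.surjective i
  constructor
  · simp [hS, τ]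
  · simp [τ, c']

section

open Polynomial

/-- The `F`-linear functionals with values in `K` on which multiplication by `X` acts as `ξ`. -/
def eigenFunctional (F : Type*) {K : Type*} [Field F] [Field K] [Algebra F K]
    (M : Type*) [AddCommGroup M] [Module F M] [Module F[X] M] (ξ : K) :
    Submodule K (M →ₗ[F] K) where
  carrier := {φ | ∀ x, φ ((X : F[X]) • x) = ξ * φ x}
  add_mem' := by
    intro φ ψ hφ hψ x
    simp [hφ x, hψ x, mul_add]
  zero_mem' := by intro x; simp
  smul_mem' := by
    intro c φ hφ x
    simp [hφ x, mul_left_comm]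

section

variable {F K M : Type*} [Field F] [Field K] [Algebra F K] [AddCommGroup M] [Module F M]
  [Module F[X] M] [IsScalarTower F F[X] M]

lemma eigenFunctional_smul {ξ : K} {φ : M →ₗ[F] K} (hφ : φ ∈ eigenFunctional F M ξ) (p : F[X])
    (x : M) : φ (p • x) = aeval ξ p * φ x := by
  induction p using Polynomial.induction_on generalizing x with
  | C a => rw [← algebraMap_eq, algebraMap_smul]; simp [Algebra.smul_def]
  | add p q hp hq => simp [add_smul, add_mul, hp, hq]
  | monomial n a ih =>
    rw [pow_succ, ← mul_assoc, mul_smul, ih, hφ x]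
    simp [mul_assoc]

/-- On a direct sum of simple modules `F[X] / I i`, the functionals of eigenvalue `ξ` form a space
whose dimension is the number of indices `i` for which `I i` is the vanishing ideal of `ξ`. -/
lemma finrank_eigenFunctional {ι : Type*} [Finite ι] (I : ι → Ideal F[X])
    (hI : ∀ i, (I i).IsMaximal) (e : M ≃ₗ[F[X]] Π i, F[X] ⧸ I i) (ξ : K) :
    finrank K (eigenFunctional F M ξ) =
      Nat.card {i // I i = RingHom.ker (aeval (R := F) ξ)} := by
  classical
  have := Fintype.ofFinite ι
  let T : eigenFunctional F M ξ →ₗ[K] ({i // I i = RingHom.ker (aeval (R := F) ξ)} → K) :=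
    { toFun := fun φ i ↦ φ.1 (e.symm (Pi.single i.1 1))
      map_add' := fun φ ψ ↦ rfl
      map_smul' := fun c φ ↦ rfl }
  have hsingle (i : ι) (p : F[X]) : (Pi.single i (Ideal.Quotient.mk (I i) p) : Π i, F[X] ⧸ I i)
      = p • Pi.single i 1 := by
    have h : Ideal.Quotient.mk (I i) p = p • (1 : F[X] ⧸ I i) :=
      (mul_one _).symm.trans (Algebra.smul_def p (1 : F[X] ⧸ I i)).symm
    rw [h]
    exact (LinearMap.single F[X] (fun i ↦ F[X] ⧸ I i) i).map_smul p 1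
  have hT : Function.Bijective T := by
    constructor
    · suffices h0 : ∀ φ, T φ = 0 → φ = 0 from fun φ ψ h ↦
        sub_eq_zero.mp (h0 _ (by rw [map_sub, h, sub_self]))
      intro φ hφ
      ext x
      obtain ⟨y, rfl⟩ := e.symm.surjective x
      rw [← Finset.univ_sum_single y, map_sum, map_sum]
      refine Finset.sum_eq_zero fun i _ ↦ ?_
      obtain ⟨p, hp⟩ := Ideal.Quotient.mk_surjective (y i)
      rw [← hp, hsingle, map_smul, eigenFunctional_smul φ.2]
      by_cases hi : I i = RingHom.ker (aeval (R := F) ξ)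
      · rw [show φ.1 (e.symm (Pi.single i 1)) = 0 from congrFun hφ ⟨i, hi⟩, mul_zero]
      · have hle : ¬ I i ≤ RingHom.ker (aeval (R := F) ξ) := fun hle ↦
          hi ((hI i).eq_of_le (RingHom.ker_ne_top _) hle)
        obtain ⟨r, hr, hr'⟩ := SetLike.not_le_iff_exists.mp hle
        have h0 := eigenFunctional_smul φ.2 r (e.symm (Pi.single i 1))
        rw [← map_smul e.symm, ← hsingle, Ideal.Quotient.eq_zero_iff_mem.mpr hr, Pi.single_zero, map_zero,
          map_zero, eq_comm, mul_eq_zero] at h0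
        rw [h0.resolve_left hr', mul_zero]
    · intro w
      let L (i : {i // I i = RingHom.ker (aeval (R := F) ξ)}) : (F[X] ⧸ I i.1) →ₐ[F] K :=
        Ideal.Quotient.liftₐ (I i.1) (aeval ξ) fun a ha ↦ by rwa [i.2] at ha
      let φ : M →ₗ[F] K := ∑ i, w i •
        ((L i).toLinearMap ∘ₗ LinearMap.proj i.1 ∘ₗ (e.restrictScalars F).toLinearMap)
      have hφ (x : M) : φ x = ∑ i, w i * L i (e x i.1) := by simp [φ]
      refine ⟨⟨φ, fun x ↦ ?_⟩, ?_⟩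
      · rw [hφ, hφ, Finset.mul_sum]
        refine Finset.sum_congr rfl fun i _ ↦ ?_
        have : (X : F[X]) • e x i.1 = Ideal.Quotient.mk (I i.1) X * e x i.1 :=
          Algebra.smul_def X (e x i.1)
        rw [map_smul, Pi.smul_apply, this, map_mul]
        have hX : L i (Ideal.Quotient.mk (I i.1) X) = ξ := aeval_X ξ
        rw [hX, mul_left_comm]
      · ext j
        change φ _ = _
        rw [hφ, Finset.sum_eq_single j]
        · simp
        · intro i _ hij
          simp [Pi.single_eq_of_ne (fun h ↦ hij (Subtype.ext h))]
        · simp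
  rw [(LinearEquiv.ofBijective T hT).finrank_eq, finrank_fintype_fun_eq_card, Nat.card_eq_fintype_card]

/-- A nonzero maximal ideal of `F[X]` is the vanishing ideal of a point of an algebraic closure. -/
lemma exists_ker_aeval_eq [IsAlgClosed K] (I : Ideal F[X]) [hI : I.IsMaximal]
    (h0 : I ≠ ⊥) : ∃ ξ : K, I = RingHom.ker (aeval (R := F) ξ) := by
  obtain ⟨f, rfl⟩ : ∃ f, I = Ideal.span {f} := ⟨_, (Ideal.span_singleton_generator I).symm⟩
  have hf0 : f ≠ 0 := by simpa using h0
  have hf : Irreducible f := (Ideal.span_singleton_prime hf0).mp hI.isPrime |>.irreducible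
  obtain ⟨ξ, hξ⟩ := IsAlgClosed.exists_aeval_eq_zero K f (degree_pos_of_irreducible hf).ne'
  refine ⟨ξ, hI.eq_of_le (RingHom.ker_ne_top _) ?_⟩
  rwa [Ideal.span_singleton_le_iff_mem]

/-- If `M` is semisimple and its eigenvalues have multiplicity divisible by the order of `ω`, then
`M` has automorphisms `u`, `g` with `u ^ orderOf ω = 1` and `g u g⁻¹ = ω u`. -/
lemma exists_linearEquiv_mul_eq_smul [IsAlgClosed K] [FiniteDimensional F M] [IsSemisimpleModule F[X] M]
    (ω : Fˣ) (hω : IsOfFinOrder ω)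
    (hdvd : ∀ ξ : K, orderOf ω ∣ finrank K (eigenFunctional F M ξ)) :
    ∃ u g : M ≃ₗ[F[X]] M, u ^ orderOf ω = 1 ∧ ∀ x, g (u x) = (ω : F) • u (g x) := by
  classical
  have : Module.Finite F[X] M := Module.Finite.of_restrictScalars_finite F _ _
  obtain ⟨k, S, e₀, hS⟩ := IsSemisimpleModule.exists_linearEquiv_fin_dfinsupp F[X] M
  have hquot (i) := isSimpleModule_iff_quot_maximal.mp (hS i)
  choose I hI e₁ using hquot
  let e : M ≃ₗ[F[X]] Π i, F[X] ⧸ I i :=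
    (e₀.trans DFinsupp.linearEquivFunOnFintype).trans (LinearEquiv.piCongrRight fun i ↦ (e₁ i).some)
  have hne (i) : I i ≠ ⊥ := by
    intro hi
    have : Module.Finite F (F[X] ⧸ I i) := Module.Finite.of_surjective
      (LinearMap.proj i ∘ₗ (e.restrictScalars F).toLinearMap)
      ((Function.surjective_eval i).comp e.surjective)
    have : Module.Finite F F[X] := Module.Finite.of_injective
      (Ideal.Quotient.mkₐ F (I i)).toLinearMap <| (injective_iff_map_eq_zero _).mpr fun p hp ↦ by
        have : p ∈ I i := Ideal.Quotient.eq_zero_iff_mem.mp hp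
        simpa [hi] using this
    exact Polynomial.not_finite this
  have hfin : Finite (Subgroup.zpowers ω) := by
    exact finite_zpowers.mpr hω
  obtain ⟨σ, c, hσ⟩ := exists_perm_coloring (G := Subgroup.zpowers ω) I (by
    intro J
    rw [Nat.card_zpowers]
    rcases isEmpty_or_nonempty {i // I i = J} with h | ⟨⟨i, rfl⟩⟩
    · simp
    · obtain ⟨ξ, hξ⟩ := exists_ker_aeval_eq (K := K) (I i) (hne i)
      have := hdvd ξ
      rwa [finrank_eigenFunctional I hI e, ← hξ] at this)
    ⟨ω, Subgroup.mem_zpowers ω⟩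
  let u : (Π i, F[X] ⧸ I i) ≃ₗ[F[X]] Π i, F[X] ⧸ I i :=
    LinearEquiv.piCongrRight fun i ↦
      LinearEquiv.smulOfUnit (Units.map (C : F →+* F[X]).toMonoidHom (c i : Fˣ))
  let g : (Π i, F[X] ⧸ I i) ≃ₗ[F[X]] Π i, F[X] ⧸ I i :=
    (LinearEquiv.piCongrLeft' F[X] (fun i ↦ F[X] ⧸ I i) σ.symm).trans
      (LinearEquiv.piCongrRight fun i ↦ Submodule.quotEquivOfEq _ _ (hσ i).1)
  have hu (x i) : u x i = C ((c i : Fˣ) : F) • x i := rfl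
  have hg (x i) : g x i = Submodule.quotEquivOfEq _ _ (hσ i).1 (x (σ i)) := rfl
  have hupow (m : ℕ) (x i) : (u ^ m) x i = C (((c i) ^ m : Fˣ) : F) • x i := by
    induction m generalizing x with
    | zero => simp
    | succ m ih => rw [pow_succ, LinearEquiv.mul_apply, ih, hu, smul_smul, ← C_mul]; simp [pow_succ]
  have hgu (x) : g (u x) = C (ω : F) • u (g x) := by
    ext1 i
    rw [hg, hu, map_smul, Pi.smul_apply, hu, hg, smul_smul, ← C_mul]
    congr 2
    simp [(hσ i).2]
  refine ⟨(e.trans u).trans e.symm, (e.trans g).trans e.symm, ?_, fun x ↦ ?_⟩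
  · have hconj (m : ℕ) (x) : (((e.trans u).trans e.symm) ^ m) x = e.symm ((u ^ m) (e x)) := by
      induction m generalizing x with
      | zero => simp
      | succ m ih => simp [pow_succ, LinearEquiv.mul_apply, ih]
    ext x
    rw [hconj]
    refine e.symm_apply_eq.mpr ?_
    ext1 i
    rw [hupow]
    have : ((c i : Fˣ)) ^ orderOf ω = 1 := by
      obtain ⟨k, hk⟩ := (c i).2
      rw [← hk, ← zpow_natCast, zpow_comm, zpow_natCast, pow_orderOf_eq_one, one_zpow]
    simp [this]
  · simp only [LinearEquiv.trans_apply, LinearEquiv.apply_symm_apply, hgu, map_smul]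
    rw [← algebraMap_eq, algebraMap_smul]
end

lemma finrank_eigenspace_transpose {n K : Type*} [Fintype n] [DecidableEq n] [Field K]
    (A : Matrix n n K) (ξ : K) :
    finrank K (End.eigenspace (Matrix.toLin' A.transpose) ξ) =
      finrank K (End.eigenspace (Matrix.toLin' A) ξ) := by
  have key (B : Matrix n n K) :
      finrank K (End.eigenspace (Matrix.toLin' B) ξ) + (B - Matrix.scalar n ξ).rank = Fintype.card n := by
    have h : Matrix.toLin' B - ξ • (1 : End K (n → K))
        = (B - Matrix.scalar n ξ).mulVecLin := by
      ext i j
      simp [Pi.single_apply]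
    rw [End.eigenspace_def, h, Matrix.rank, add_comm, LinearMap.finrank_range_add_finrank_ker,
      finrank_fintype_fun_eq_card]
  have h := key A.transpose
  rw [← Matrix.rank_transpose] at h
  have h' : (A.transpose - Matrix.scalar n ξ).transpose = A - Matrix.scalar n ξ := by simp
  rw [h', ← key A] at h
  omega

lemma finrank_eigenFunctional_toLin' {n F K : Type*} [Fintype n] [DecidableEq n] [Field F]
    [Field K] [Algebra F K] (A : Matrix n n F) (ξ : K) :
    finrank K (eigenFunctional F (AEval' (Matrix.toLin' A)) ξ) =
      finrank K (End.eigenspace (Matrix.toLin' (A.map (algebraMap F K))) ξ) := by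
  let b := (Pi.basisFun F n).map (AEval'.of (Matrix.toLin' A))
  have hb (j) : (X : F[X]) • b j = ∑ i, A i j • b i := by
    have h : Matrix.toLin' A (Pi.single j 1) = ∑ i, A i j • (Pi.single i 1 : n → F) := by
      ext i
      simp [Finset.sum_apply, Pi.single_apply]
    have hb' (i) : b i = AEval'.of (Matrix.toLin' A) (Pi.single i 1) := by simp [b]
    simp_rw [hb', ← map_smul, ← map_sum, ← h]
    exact AEval.X_smul_of _ _
  have hmap : eigenFunctional F (AEval' (Matrix.toLin' A)) ξ =
      (End.eigenspace (Matrix.toLin' (A.map (algebraMap F K)).transpose) ξ).map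
        (b.constr K).toLinearMap := by
    ext φ
    obtain ⟨w, rfl⟩ := (b.constr K).surjective φ
    have h : b.constr K w ∈ eigenFunctional F (AEval' (Matrix.toLin' A)) ξ ↔
        ∀ j, b.constr K w ((X : F[X]) • b j) = ξ * b.constr K w (b j) := by
      refine ⟨fun h j ↦ h _, fun h ↦ ?_⟩
      have hlin : (b.constr K w) ∘ₗ (DistribSMul.toLinearMap F _ (X : F[X])) =
          ξ • b.constr K w := b.ext h
      exact LinearMap.congr_fun hlin
    rw [h, Submodule.mem_map_equiv, LinearEquiv.symm_apply_apply, End.mem_eigenspace_iff,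
      funext_iff]
    refine forall_congr' fun j ↦ ?_
    simp [hb, Matrix.mulVec, dotProduct, Algebra.smul_def]
  rw [← finrank_eigenspace_transpose, hmap, LinearEquiv.finrank_map_eq]

/-- If `U` and `G` commute with `S`, `U G = ζ G U` with `G` injective, and `U ^ N = 1` with `ζ` a
primitive `N`-th root of unity, then `U` has all the powers of `ζ` as its eigenvalues on each
eigenspace of `S`. -/
lemma setOf_eigenspace_inf_ne_bot {K V : Type*} [Field K] [IsAlgClosed K] [AddCommGroup V]
    [Module K V] [FiniteDimensional K V] {S U G : End K V} {N : ℕ} {ζ ξ : K} (hN : 0 < N)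
    (hG : Function.Injective G) (hSU : Commute S U) (hSG : Commute S G) (hUG : U * G = ζ • (G * U))
    (hζ : IsPrimitiveRoot ζ N) (hU : U ^ N = 1) (hξ : S.HasEigenvalue ξ) :
    {μ | S.eigenspace ξ ⊓ U.eigenspace μ ≠ ⊥} = {x | ∃ i < N, x = ζ ^ i} := by
  have hmem (μ : K) : S.eigenspace ξ ⊓ U.eigenspace μ ≠ ⊥ ↔
      ∃ v, v ≠ 0 ∧ S v = ξ • v ∧ U v = μ • v := by
    simp [Submodule.ne_bot_iff, and_comm]
  have hroot (μ : K) (v : V) (hv : v ≠ 0) (h : U v = μ • v) : ∃ i < N, ζ ^ i = μ := by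
    have : NeZero N := ⟨hN.ne'⟩
    refine hζ.eq_pow_of_pow_eq_one ?_
    have hpow (k : ℕ) : (U ^ k) v = μ ^ k • v := by
      induction k with
      | zero => simp
      | succ k ih => rw [pow_succ', Module.End.mul_apply, ih, map_smul, h, smul_smul, pow_succ]
    have h1 := hpow N
    rw [hU, Module.End.one_apply] at h1
    exact smul_left_injective K hv (by simpa using h1.symm)
  have hstep (μ : K) (k : ℕ) (h : ∃ v, v ≠ 0 ∧ S v = ξ • v ∧ U v = μ • v) :
      ∃ v, v ≠ 0 ∧ S v = ξ • v ∧ U v = (ζ ^ k * μ) • v := by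
    induction k with
    | zero => simpa using h
    | succ k ih =>
      obtain ⟨v, hv, hS, hU⟩ := ih
      refine ⟨G v, fun h0 ↦ hv (hG (by rw [h0, map_zero])), ?_, ?_⟩
      · rw [← Module.End.mul_apply, hSG.eq, Module.End.mul_apply, hS, map_smul]
      · rw [← Module.End.mul_apply, hUG, LinearMap.smul_apply, Module.End.mul_apply, hU, map_smul,
          smul_smul, pow_succ', mul_assoc]
  obtain ⟨μ, v, hv, hSv, hUv⟩ : ∃ μ v, v ≠ 0 ∧ S v = ξ • v ∧ U v = μ • v := by
    have hmaps : ∀ v ∈ S.eigenspace ξ, U v ∈ S.eigenspace ξ := fun v hv ↦ by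
      rw [End.mem_eigenspace_iff] at hv ⊢
      rw [← Module.End.mul_apply, hSU.eq, Module.End.mul_apply, hv, map_smul]
    have : Nontrivial (S.eigenspace ξ) := Submodule.nontrivial_iff_ne_bot.mpr hξ
    obtain ⟨μ, hμ⟩ := End.exists_eigenvalue (LinearMap.restrict U hmaps)
    obtain ⟨v, hv⟩ := hμ.exists_hasEigenvector
    exact ⟨μ, v, by simpa using hv.2, End.mem_eigenspace_iff.mp v.2,
      congrArg Subtype.val hv.apply_eq_smul⟩
  obtain ⟨j, hj, rfl⟩ := hroot μ v hv hUv
  ext x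
  simp only [Set.mem_ofPred_eq, hmem]
  constructor
  · rintro ⟨w, hw, -, hUw⟩
    obtain ⟨i, hi, rfl⟩ := hroot x w hw hUw
    exact ⟨i, hi, rfl⟩
  · rintro ⟨i, -, rfl⟩
    have h := hstep (ζ ^ j) (i + (N - j)) ⟨v, hv, hSv, hUv⟩
    rwa [← pow_add, add_assoc, Nat.sub_add_cancel hj.le, pow_add, hζ.pow_eq_one, mul_one] at h

section

variable {n : ℕ} {F K : Type*} [Field F] [Field K] [Algebra F K]

lemma glToEnd_mul (g h : GL (Fin n) F) :
    glToEnd (K := K) (g * h) = glToEnd g * glToEnd h := by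
  simp [glToEnd, Matrix.map_mul, Matrix.toLin'_mul, Module.End.mul_eq_comp]

lemma glToEnd_one : glToEnd (K := K) (1 : GL (Fin n) F) = 1 := by
  simp [glToEnd, Module.End.one_eq_id]

lemma glToEnd_pow (g : GL (Fin n) F) (m : ℕ) :
    glToEnd (K := K) (g ^ m) = glToEnd g ^ m := by
  induction m with
  | zero => simp [glToEnd_one]
  | succ m ih => rw [pow_succ, pow_succ, glToEnd_mul, ih]

lemma glToEnd_scalarGL (z : Fˣ) :
    glToEnd (K := K) (scalarGL z : GL (Fin n) F) = algebraMap F K (z : F) • (1 : End K (Fin n → K)) := by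
  have h : ((scalarGL z : GL (Fin n) F) : Matrix (Fin n) (Fin n) F).map (algebraMap F K) =
      Matrix.diagonal fun _ ↦ algebraMap F K (z : F) := by
    simp [scalarGL, Matrix.diagonal_map]
  rw [glToEnd, h]
  ext
  simp [Matrix.mulVec_diagonal, Algebra.smul_def]

lemma glToEnd_injective (g : GL (Fin n) F) : Function.Injective (glToEnd (K := K) g) := by
  refine Function.LeftInverse.injective (g := glToEnd g⁻¹) fun v ↦ ?_
  rw [← Module.End.mul_apply, ← glToEnd_mul, inv_mul_cancel, glToEnd_one, Module.End.one_apply]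

lemma scalarGL_mul_comm (z : Fˣ) (g : GL (Fin n) F) : scalarGL z * g = g * scalarGL z := by
  ext1
  exact (Matrix.scalar_commute (z : F) (fun _ ↦ Commute.all _ _) (g : Matrix (Fin n) (Fin n) F)).eq

lemma scalarGL_pow (z : Fˣ) (m : ℕ) : scalarGL (n := n) (z ^ m) = scalarGL z ^ m :=
  map_pow _ z m

lemma scalarGL_one : scalarGL (n := n) (1 : Fˣ) = 1 :=
  map_one _

lemma scalarGL_mul (z w : Fˣ) : scalarGL (n := n) (z * w) = scalarGL z * scalarGL w :=
  map_mul _ z w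

lemma scalarGL_injective [NeZero n] : Function.Injective (scalarGL (n := n) (F := F)) :=
  Units.map_injective fun _ _ h ↦ Matrix.scalar_inj.mp h

/-- The matrix of an `F[X]`-linear automorphism of the `F[X]`-module attached to a matrix. -/
noncomputable def aevalAutToGL (A : Matrix (Fin n) (Fin n) F) :
    (AEval' (Matrix.toLin' A) ≃ₗ[F[X]] AEval' (Matrix.toLin' A)) →* GL (Fin n) F :=
  (Units.map (M := End F (Fin n → F))
    (LinearMap.toMatrixAlgEquiv' : _ ≃ₐ[F] Matrix (Fin n) (Fin n) F).toMonoidHom).comp <|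
  (LinearMap.GeneralLinearGroup.generalLinearEquiv F (Fin n → F)).symm.toMonoidHom.comp
    { toFun := fun φ ↦ ((AEval'.of _).trans (φ.restrictScalars F)).trans (AEval'.of _).symm
      map_one' := rfl
      map_mul' := fun _ _ ↦ rfl }

lemma aevalAutToGL_mulVec (A : Matrix (Fin n) (Fin n) F)
    (φ : AEval' (Matrix.toLin' A) ≃ₗ[F[X]] AEval' (Matrix.toLin' A)) (v : Fin n → F) :
    (aevalAutToGL A φ : Matrix (Fin n) (Fin n) F).mulVec v =
      (AEval'.of _).symm (φ (AEval'.of _ v)) :=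
  LinearMap.toMatrix'_mulVec _ v

lemma aevalAutToGL_mul_comm (s : GL (Fin n) F)
    (φ : AEval' (Matrix.toLin' (s : Matrix (Fin n) (Fin n) F)) ≃ₗ[F[X]]
      AEval' (Matrix.toLin' (s : Matrix (Fin n) (Fin n) F))) :
    aevalAutToGL _ φ * s = s * aevalAutToGL _ φ := by
  ext1
  refine Matrix.mulVec_injective (funext fun v ↦ ?_)
  have h := AEval'.X_smul_of (Matrix.toLin' (s : Matrix (Fin n) (Fin n) F)) v
  have h' := congrArg (AEval'.of (Matrix.toLin' (s : Matrix (Fin n) (Fin n) F))).symm (φ.map_smul X (AEval'.of _ v))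
  rw [h, AEval.of_symm_X_smul] at h'
  simpa [← Matrix.mulVec_mulVec, aevalAutToGL_mulVec] using h'

/-- A semisimple matrix all of whose eigenvalues have multiplicity divisible by the order of `ω`
is centralised by matrices `u`, `g` with `u ^ orderOf ω = 1` and `g u g⁻¹ = ω u`. -/
lemma exists_GL_mul_eq_scalarGL_mul [IsAlgClosed K] (s : GL (Fin n) F)
    (hs : End.IsSemisimple (Matrix.toLin' (s : Matrix (Fin n) (Fin n) F)))
    (ω : Fˣ) (hω : IsOfFinOrder ω)
    (hdvd : ∀ ξ : K, orderOf ω ∣ finrank K ((glToEnd (K := K) s).eigenspace ξ)) :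
    ∃ u g : GL (Fin n) F, u ^ orderOf ω = 1 ∧ u * s = s * u ∧ g * s = s * g ∧
      g * u = scalarGL ω * (u * g) := by
  have : IsSemisimpleModule F[X] (AEval' (Matrix.toLin' (s : Matrix (Fin n) (Fin n) F))) := hs
  obtain ⟨u, g, hu, hgu⟩ := exists_linearEquiv_mul_eq_smul (K := K)
    (M := AEval' (Matrix.toLin' (s : Matrix (Fin n) (Fin n) F))) ω hω fun ξ ↦ by
      rw [finrank_eigenFunctional_toLin']
      exact hdvd ξ
  refine ⟨aevalAutToGL _ u, aevalAutToGL _ g, by rw [← map_pow, hu, map_one],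
    aevalAutToGL_mul_comm s u, aevalAutToGL_mul_comm s g, ?_⟩
  ext1
  refine Matrix.mulVec_injective (funext fun v ↦ ?_)
  simp [← Matrix.mulVec_mulVec, aevalAutToGL_mulVec, hgu, scalarGL]

end

/-- A matrix whose order is nonzero in the field is semisimple. -/
lemma isSemisimple_toLin'_of_orderOf {n : ℕ} {F : Type*} [Field F] (s : GL (Fin n) F)
    (hs : (orderOf s : F) ≠ 0) :
    End.IsSemisimple (Matrix.toLin' (s : Matrix (Fin n) (Fin n) F)) := by
  refine End.isSemisimple_of_squarefree_aeval_eq_zero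
    (separable_X_pow_sub_C 1 hs one_ne_zero).squarefree ?_
  have h : (s : Matrix (Fin n) (Fin n) F) ^ orderOf s = 1 := by
    rw [← Units.val_pow_eq_pow_val, pow_orderOf_eq_one, Units.val_one]
  rw [map_sub, map_pow, aeval_X, aeval_C, map_one, ← Matrix.toLin'_pow, h, Matrix.toLin'_one]
  exact sub_self _

end

/-- The scalars `z` of order prime to that of `s` for which `z s u` is conjugate to `s u` are
exactly the powers of `ω`. -/
lemma conj_scalarGL_mul_iff {n : ℕ} [NeZero n] {F : Type*} [Field F] {s u g : GL (Fin n) F}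
    {ω : Fˣ} (hω : 0 < orderOf ω) (hu : u ^ orderOf ω = 1) (hus : u * s = s * u)
    (hgs : g * s = s * g) (hgu : g * u = scalarGL ω * (u * g)) {z : Fˣ}
    (hz : (orderOf z).Coprime (orderOf s)) :
    (∃ h : GL (Fin n) F, h * (scalarGL z * (s * u)) * h⁻¹ = s * u) ↔ ∃ i, ω ^ i = z := by
  constructor
  · rintro ⟨h, hh⟩
    have hpow : (s * u) ^ (orderOf s * orderOf ω) = 1 := by
      rw [Commute.mul_pow (hus.symm : Commute s u), pow_mul, pow_orderOf_eq_one, one_pow, mul_comm,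
        pow_mul, hu, one_pow, one_mul]
    have h1 := congrArg (· ^ (orderOf s * orderOf ω)) hh
    simp only [conj_pow] at h1
    rw [Commute.mul_pow (scalarGL_mul_comm z (s * u)), hpow, mul_one, ← scalarGL_pow,
      ← scalarGL_mul_comm, mul_inv_cancel_right] at h1
    have hz1 : z ^ (orderOf s * orderOf ω) = 1 :=
      scalarGL_injective (h1.trans scalarGL_one.symm)
    have hz2 : z ^ orderOf ω = 1 :=
      orderOf_dvd_iff_pow_eq_one.mp (hz.dvd_of_dvd_mul_left (orderOf_dvd_of_pow_eq_one hz1))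
    have : NeZero (orderOf ω) := ⟨hω.ne'⟩
    obtain ⟨i, -, hi⟩ := ((IsPrimitiveRoot.orderOf ω).map_of_injective
      (f := Units.coeHom F) Units.val_injective).eq_pow_of_pow_eq_one (ξ := (z : F))
      (by rw [← Units.val_pow_eq_pow_val, hz2, Units.val_one])
    exact ⟨i, Units.ext (by simpa using hi)⟩
  · rintro ⟨i, rfl⟩
    have hpow : g ^ i * (s * u) = scalarGL (ω ^ i) * (s * u) * g ^ i := by
      have hgsu : SemiconjBy g (s * u) (scalarGL ω * (s * u)) := by
        rw [SemiconjBy, ← mul_assoc, hgs, mul_assoc, hgu, ← mul_assoc s, ← scalarGL_mul_comm]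
        simp only [mul_assoc]
      clear hz
      induction i with
      | zero => simp [scalarGL_one]
      | succ i ih =>
        rw [pow_succ', mul_assoc, ih, ← mul_assoc, ← mul_assoc, ← scalarGL_mul_comm, mul_assoc (scalarGL _),
          hgsu.eq, pow_succ, scalarGL_mul]
        simp only [mul_assoc]
    refine ⟨(g ^ i)⁻¹, ?_⟩
    rw [mul_assoc, inv_inv, ← hpow, inv_mul_cancel_left]

/-- general linear case of Proposition 4.4 of the paper.
Let `s ∈ GL_n(𝔽_q)` be a semisimple `ℓ'`-element (order coprime to `p` and `ℓ`), let
`ℓ^a ∣ q - 1` and `ℓ^a ∣ dim ker (s - ξ)` for every eigenvalue `ξ` of `s` over an algebraic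
closure `K`, and let `ω ∈ 𝔽_q^×` have order `ℓ^a`.  Then there is an `ℓ`-element
`u ∈ GL_n(𝔽_q)` commuting with `s` such that (1) for every eigenvalue `ξ` of `s` the set of
eigenvalues of `u` on `ker (s - ξ)` is exactly `{ω^i : 0 ≤ i < ℓ^a}` (independent of `ξ`);
and (2) the set of scalars `z ∈ 𝔽_q^×` of `ℓ`-power order with `z·su` conjugate to `su` in
`GL_n(𝔽_q)` has exactly `ℓ^a` elements. -/
theorem stmt8 {p q ℓ : ℕ} (hp : p.Prime) (hl : ℓ.Prime) (k₀ : ℕ) (hk₀ : 0 < k₀)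
    (hq : q = p ^ k₀) (hlq : ¬ ℓ ∣ q)
    {n : ℕ} (hn : 1 ≤ n)
    (Fq : Type*) [Field Fq] [Fintype Fq] (hcard : Fintype.card Fq = q)
    (K : Type*) [Field K] [IsAlgClosed K] [Algebra Fq K]
    (s : GL (Fin n) Fq)
    (hs_p : Nat.Coprime (orderOf s) p) (hs_l : Nat.Coprime (orderOf s) ℓ)
    (a : ℕ) (hdvd : ℓ ^ a ∣ q - 1)
    (hdim : ∀ ξ : K, (glToEnd (K := K) s).HasEigenvalue ξ →
      ℓ ^ a ∣ finrank K ((glToEnd (K := K) s).eigenspace ξ))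
    (ω : Fqˣ) (hω : orderOf ω = ℓ ^ a) :
    ∃ u : GL (Fin n) Fq,
      (∃ m : ℕ, orderOf u = ℓ ^ m) ∧
      u * s = s * u ∧
      (∀ ξ : K, (glToEnd (K := K) s).HasEigenvalue ξ →
        {ω' : K | (glToEnd (K := K) s).eigenspace ξ ⊓ (glToEnd (K := K) u).eigenspace ω' ≠ ⊥}
          = {x : K | ∃ i : ℕ, i < ℓ ^ a ∧ x = (algebraMap Fq K (ω : Fq)) ^ i}) ∧
      Set.ncard {z : Fqˣ | (∃ m : ℕ, orderOf z = ℓ ^ m) ∧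
        ∃ g : GL (Fin n) Fq, g * (scalarGL z * (s * u)) * g⁻¹ = s * u} = ℓ ^ a := by
  have : NeZero n := ⟨by omega⟩
  have hp' : Fact p.Prime := ⟨hp⟩
  have hω0 : 0 < orderOf ω := orderOf_pos ω
  have hs0 : (orderOf s : Fq) ≠ 0 := by
    have hchar : CharP Fq p := charP_of_card_eq_prime_pow (hcard.trans hq)
    rw [Ne, CharP.cast_eq_zero_iff Fq p, ← hp.coprime_iff_not_dvd]
    exact hs_p.symm
  obtain ⟨u, g, hu, hus, hgs, hgu⟩ := exists_GL_mul_eq_scalarGL_mul (K := K) s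
    (isSemisimple_toLin'_of_orderOf s hs0) ω (isOfFinOrder_of_finite ω) fun ξ ↦ by
      by_cases hξ : (glToEnd (K := K) s).HasEigenvalue ξ
      · exact hω ▸ hdim ξ hξ
      · rw [End.hasEigenvalue_iff, not_not] at hξ
        rw [hξ, finrank_bot]
        exact dvd_zero _
  refine ⟨u, ?_, hus, fun ξ hξ ↦ ?_, ?_⟩
  · obtain ⟨m, -, hm⟩ := (Nat.dvd_prime_pow hl).mp (hω ▸ orderOf_dvd_of_pow_eq_one hu)
    exact ⟨m, hm⟩
  · have hgu' : u * g⁻¹ = scalarGL ω * (g⁻¹ * u) := by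
      rw [mul_inv_eq_iff_eq_mul, ← mul_assoc, scalarGL_mul_comm, mul_assoc g⁻¹, ← mul_assoc,
        mul_assoc, mul_assoc, eq_inv_mul_iff_mul_eq]
      exact hgu
    refine setOf_eigenspace_inf_ne_bot (G := glToEnd g⁻¹) (hω ▸ hω0) (glToEnd_injective _)
      ?_ ?_ ?_ ?_ ?_ hξ
    · rw [Commute, SemiconjBy, ← glToEnd_mul, ← hus, glToEnd_mul]
    · rw [Commute, SemiconjBy, ← glToEnd_mul, ← glToEnd_mul,
        (Commute.inv_right (hgs.symm : Commute s g)).eq]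
    · rw [← glToEnd_mul, hgu', glToEnd_mul, glToEnd_scalarGL, glToEnd_mul, smul_mul_assoc, one_mul]
    · rw [← hω]
      exact (IsPrimitiveRoot.orderOf ω).map_of_injective
        (f := ((algebraMap Fq K : Fq →* K).comp (Units.coeHom Fq)))
        ((algebraMap Fq K).injective.comp Units.val_injective)
    · rw [← glToEnd_pow, ← hω, hu, glToEnd_one]
  · have hset : {z : Fqˣ | (∃ m : ℕ, orderOf z = ℓ ^ m) ∧
        ∃ g : GL (Fin n) Fq, g * (scalarGL z * (s * u)) * g⁻¹ = s * u} =
        (Subgroup.zpowers ω : Set Fqˣ) := by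
      ext z
      rw [SetLike.mem_coe, ← mem_powers_iff_mem_zpowers, Submonoid.mem_powers_iff]
      constructor
      · rintro ⟨⟨m, hm⟩, hz⟩
        exact (conj_scalarGL_mul_iff hω0 hu hus hgs hgu
          (hm ▸ (Nat.Coprime.pow_left m hs_l.symm))).mp hz
      · rintro ⟨i, hi⟩
        have hdvd' : orderOf z ∣ ℓ ^ a := by
          rw [← hi, ← hω]
          exact orderOf_pow_dvd i
        obtain ⟨m, -, hm⟩ := (Nat.dvd_prime_pow hl).mp hdvd'
        exact ⟨⟨m, hm⟩, (conj_scalarGL_mul_iff hω0 hu hus hgs hgu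
          (hm ▸ (Nat.Coprime.pow_left m hs_l.symm))).mpr ⟨i, hi⟩⟩
    rw [hset, ← hω, ← Nat.card_zpowers]
    rfl
end

section
/- Let u ∈ GL_m(F) be unipotent with Jordan type λ = (λ₁ ≥ λ₂ ≥ … ≥ λ_r), and set d = gcd(Q − 1, λ₁, λ₂, …, λ_r). Then the image of the centralizer of u in GL_m(F) under the determinant map equals {x^d : x ∈ F^×}, the unique subgroup of index d of F^×. -/
/-- Determinants are multiplicative along a surjection intertwining two endomorphisms. -/
theorem LinearMap.det_eq_det_restrict_ker_mul_det {F V W : Type*} [Field F]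
    [AddCommGroup V] [Module F V] [FiniteDimensional F V] [AddCommGroup W] [Module F W]
    (p : V →ₗ[F] W) (hp : Function.Surjective p) (g : V →ₗ[F] V) (h : W →ₗ[F] W)
    (hgh : ∀ x, p (g x) = h (p x)) (hker : ∀ x ∈ LinearMap.ker p, g x ∈ LinearMap.ker p) :
    LinearMap.det g = LinearMap.det (g.restrict hker) * LinearMap.det h := by
  rw [LinearMap.det_eq_det_mul_det (LinearMap.ker p) g hker]
  congr 1
  rw [← LinearMap.det_conj _ (p.quotKerEquivOfSurjective hp)]
  congr 1
  ext y
  obtain ⟨x, rfl⟩ := hp y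
  have hx : (p.quotKerEquivOfSurjective hp).symm (p x) = (LinearMap.ker p).mkQ x := by
    rw [LinearEquiv.symm_apply_eq]; rfl
  simp only [LinearMap.comp_apply, LinearEquiv.coe_coe, hx]
  exact hgh x

/-- If `g` commutes with `f`, the determinant of `g` on an invariant subspace `W` is the product
of its determinants on `ker f ⊓ W` and on `f W`. -/
theorem LinearMap.det_restrict_eq_mul_of_commute {F V : Type*} [Field F]
    [AddCommGroup V] [Module F V] [FiniteDimensional F V]
    (f g : V →ₗ[F] V) (hfg : ∀ x, f (g x) = g (f x)) (W : Submodule F V)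
    (hW : ∀ x ∈ W, g x ∈ W) (hK : ∀ x ∈ LinearMap.ker f ⊓ W, g x ∈ LinearMap.ker f ⊓ W)
    (hM : ∀ x ∈ W.map f, g x ∈ W.map f) :
    LinearMap.det (g.restrict hW) =
      LinearMap.det (g.restrict hK) * LinearMap.det (g.restrict hM) := by
  have hker : ∀ x ∈ LinearMap.ker (f.submoduleMap W),
      g.restrict hW x ∈ LinearMap.ker (f.submoduleMap W) := by
    intro x hx
    have hx' : f x = 0 := congrArg Subtype.val hx
    refine Subtype.ext ?_
    change f (g x) = 0
    rw [hfg, hx', map_zero]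
  rw [LinearMap.det_eq_det_restrict_ker_mul_det (f.submoduleMap W) (f.submoduleMap_surjective W)
    (g.restrict hW) (g.restrict hM) (fun x => Subtype.ext (hfg x)) hker]
  congr 1
  let e : LinearMap.ker (f.submoduleMap W) ≃ₗ[F] (LinearMap.ker f ⊓ W : Submodule F V) :=
    { toFun := fun x => ⟨x.1.1, congrArg Subtype.val x.2, x.1.2⟩
      map_add' := fun _ _ => rfl
      map_smul' := fun _ _ => rfl
      invFun := fun x => ⟨⟨x.1, x.2.2⟩, Subtype.ext x.2.1⟩
      left_inv := fun _ => rfl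
      right_inv := fun _ => rfl }
  rw [← LinearMap.det_conj _ e]
  rfl

theorem LinearMap.finrank_ker_inf_add_finrank_map {F V : Type*} [Field F]
    [AddCommGroup V] [Module F V] [FiniteDimensional F V] (f : V →ₗ[F] V) (W : Submodule F V) :
    Module.finrank F (LinearMap.ker f ⊓ W : Submodule F V) + Module.finrank F (W.map f) =
      Module.finrank F W := by
  have h := (f.domRestrict W).finrank_range_add_finrank_ker
  rw [LinearMap.range_domRestrict, LinearMap.ker_domRestrict,
    ← Submodule.finrank_map_subtype_eq, Submodule.map_comap_subtype, inf_comm] at h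
  omega

theorem LinearMap.map_range_pow {F V : Type*} [Field F] [AddCommGroup V] [Module F V]
    (f : V →ₗ[F] V) (k : ℕ) :
    (LinearMap.range (f ^ k)).map f = LinearMap.range (f ^ (k + 1)) := by
  rw [pow_succ', Module.End.mul_eq_comp, LinearMap.range_comp]

/-- If the spaces `ker f ⊓ range (f ^ k)` can only jump at multiples of `d`, then every
automorphism commuting with the nilpotent `f` has a `d`-th power as its determinant. -/
theorem LinearMap.exists_det_eq_pow_of_commute {F V : Type*} [Field F]
    [AddCommGroup V] [Module F V] [FiniteDimensional F V]
    (f g : V →ₗ[F] V) (hf : IsNilpotent f) (hfg : Commute f g) {d : ℕ} (hd : 0 < d)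
    (hK : ∀ k, ¬ d ∣ k + 1 → LinearMap.ker f ⊓ LinearMap.range (f ^ k) =
      LinearMap.ker f ⊓ LinearMap.range (f ^ (k + 1))) :
    ∃ y : F, LinearMap.det g = y ^ d := by
  have hfg' : ∀ x, f (g x) = g (f x) := fun x => LinearMap.congr_fun hfg.eq x
  have hR : ∀ k, ∀ x ∈ LinearMap.range (f ^ k), g x ∈ LinearMap.range (f ^ k) := by
    rintro k _ ⟨x, rfl⟩
    exact ⟨g x, LinearMap.congr_fun (hfg.pow_left k).eq x⟩
  have hI : ∀ k, ∀ x ∈ LinearMap.ker f ⊓ LinearMap.range (f ^ k),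
      g x ∈ LinearMap.ker f ⊓ LinearMap.range (f ^ k) := by
    rintro k x ⟨hx, hx'⟩
    refine ⟨?_, hR k x hx'⟩
    have : f x = 0 := hx
    change f (g x) = 0
    rw [hfg', this, map_zero]
  let D : ℕ → F := fun k => LinearMap.det (g.restrict (hR k))
  let r : ℕ → F := fun k => LinearMap.det (g.restrict (hI k))
  have det_congr : ∀ (A B : Submodule F V) (hA : ∀ x ∈ A, g x ∈ A) (hB : ∀ x ∈ B, g x ∈ B),
      A = B → LinearMap.det (g.restrict hA) = LinearMap.det (g.restrict hB) := by
    rintro A _ hA hB rfl; rfl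
  have hD : ∀ k, D k = r k * D (k + 1) := by
    intro k
    have hM : ∀ x ∈ (LinearMap.range (f ^ k)).map f, g x ∈ (LinearMap.range (f ^ k)).map f := by
      rw [LinearMap.map_range_pow]; exact hR (k + 1)
    rw [show D (k + 1) = LinearMap.det (g.restrict hM) from
      det_congr _ _ _ _ (LinearMap.map_range_pow f k).symm]
    exact LinearMap.det_restrict_eq_mul_of_commute f g hfg' _ _ _ _
  have hr : ∀ k, ¬ d ∣ k + 1 → r k = r (k + 1) := fun k hk => det_congr _ _ _ _ (hK k hk)
  have hrj : ∀ j i, i < d → r (d * j + i) = r (d * j) := by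
    intro j i hi
    induction i with
    | zero => rfl
    | succ i ih =>
      rw [← ih (by omega), ← add_assoc]
      refine (hr _ fun h => ?_).symm
      rw [add_assoc, Nat.dvd_add_right (dvd_mul_right d j)] at h
      exact absurd (Nat.le_of_dvd (Nat.succ_pos i) h) (by omega)
  have hDi : ∀ j i, i ≤ d → D (d * j) = r (d * j) ^ i * D (d * j + i) := by
    intro j i hi
    induction i with
    | zero => simp
    | succ i ih => rw [ih (by omega), hD (d * j + i), hrj j i (by omega), ← add_assoc]; ring
  have hDj : ∀ j, ∃ y, D 0 = y ^ d * D (d * j) := by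
    intro j
    induction j with
    | zero => exact ⟨1, by simp⟩
    | succ j ih =>
      obtain ⟨y, hy⟩ := ih
      exact ⟨y * r (d * j), by rw [hy, hDi j d le_rfl, mul_add_one]; ring⟩
  obtain ⟨n, hn⟩ := hf
  obtain ⟨y, hy⟩ := hDj n
  have hbot : LinearMap.range (f ^ (d * n)) = ⊥ := by
    rw [mul_comm, pow_mul, hn, zero_pow hd.ne', LinearMap.range_zero]
  have hD1 : D (d * n) = 1 := by
    have : Subsingleton (LinearMap.range (f ^ (d * n))) := by rw [hbot]; infer_instance
    exact LinearMap.det_eq_one_of_subsingleton _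
  have hD0 : D 0 = LinearMap.det g := by
    have htop : LinearMap.range (f ^ 0) = ⊤ := by
      rw [pow_zero, Module.End.one_eq_id, LinearMap.range_id]
    let e : LinearMap.range (f ^ 0) ≃ₗ[F] V := LinearEquiv.ofTop _ htop
    change LinearMap.det (g.restrict (hR 0)) = _
    rw [← LinearMap.det_conj _ e]
    rfl
  exact ⟨y, by rw [← hD0, hy, hD1, mul_one]⟩

open Matrix in
/-- A Jordan block of size `l` of `N`, detected by a vector `w` with `N ^ l *ᵥ w = 0` and a
functional `φ` killing the range of `N ^ l` but not `N ^ (l - 1) *ᵥ w`, gives matrices commuting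
with `N` of determinant `x ^ l`. -/
theorem Matrix.exists_commute_det_eq_pow {F ι : Type*} [Field F] [Fintype ι] [DecidableEq ι]
    (N : Matrix ι ι F) (l : ℕ) (w φ : ι → F) (hw : N ^ l *ᵥ w = 0) (hφ : φ ᵥ* N ^ l = 0)
    (hφw : φ ⬝ᵥ N ^ (l - 1) *ᵥ w ≠ 0) (x : F) :
    ∃ g : Matrix ι ι F, Commute g N ∧ g.det = x ^ l := by
  let S : Matrix ι (Fin l) F := Matrix.of fun i j => (N ^ (l - 1 - j.val) *ᵥ w) i
  let P : Matrix (Fin l) ι F := Matrix.of fun i j => (φ ᵥ* N ^ i.val) j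
  let J : Matrix (Fin l) (Fin l) F := Matrix.of fun i j => if i.val + 1 = j.val then 1 else 0
  have hPN : P * N = J * P := by
    ext i j
    have h1 : (P * N) i j = (φ ᵥ* N ^ (i.val + 1)) j := by
      rw [pow_succ, ← Matrix.vecMul_vecMul]; rfl
    rw [h1, Matrix.mul_apply]
    by_cases hi : i.val + 1 < l
    · rw [Finset.sum_eq_single ⟨i.val + 1, hi⟩]
      · simp [J, P]
      · intro b _ hb
        have : i.val + 1 ≠ b.val := fun h => hb (Fin.ext h.symm)
        simp [J, this]
      · simp
    · have hil : i.val + 1 = l := by omega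
      rw [hil, hφ, Finset.sum_eq_zero]
      · rfl
      · intro b _
        have : i.val + 1 ≠ b.val := by omega
        simp [J, this]
  have hNS : N * S = S * J := by
    ext i j
    have h1 : (N * S) i j = (N ^ (l - 1 - j.val + 1) *ᵥ w) i := by
      rw [pow_succ', ← Matrix.mulVec_mulVec]; rfl
    rw [h1, Matrix.mul_apply]
    by_cases hj : j.val = 0
    · have : l - 1 - j.val + 1 = l := by omega
      rw [this, hw, Finset.sum_eq_zero]
      · rfl
      · intro b _
        have : b.val + 1 ≠ j.val := by omega
        simp [J, this]
    · rw [Finset.sum_eq_single ⟨j.val - 1, by omega⟩]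
      · have h2 : j.val - 1 + 1 = j.val := by omega
        have h3 : l - 1 - j.val + 1 = l - 1 - (j.val - 1) := by omega
        simp [J, S, h2, h3]
      · intro b _ hb
        have : b.val + 1 ≠ j.val := fun h => hb (Fin.ext (by simp; omega))
        simp [J, this]
      · simp
  have hT : ∀ i j : Fin l, (P * S) i j = φ ⬝ᵥ N ^ (i.val + (l - 1 - j.val)) *ᵥ w := by
    intro i j
    rw [pow_add, ← Matrix.mulVec_mulVec, Matrix.dotProduct_mulVec]
    rfl
  have hTtri : (P * S).BlockTriangular id := by
    intro i j hij
    have hij' : j.val < i.val := hij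
    rw [hT, show i.val + (l - 1 - j.val) = (i.val - j.val - 1) + l by omega, pow_add,
      ← Matrix.mulVec_mulVec, hw, Matrix.mulVec_zero, dotProduct_zero]
  have hTdet : IsUnit (P * S).det := by
    rw [Matrix.det_of_isUpperTriangular hTtri, isUnit_iff_ne_zero, Finset.prod_ne_zero_iff]
    intro i _
    rw [hT, show i.val + (l - 1 - i.val) = l - 1 by omega]
    exact hφw
  have hTJ : Commute (P * S) J := by
    change P * S * J = J * (P * S)
    rw [Matrix.mul_assoc, ← hNS, ← Matrix.mul_assoc, hPN, Matrix.mul_assoc]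
  have hTiJ : (P * S)⁻¹ * J = J * (P * S)⁻¹ := by
    calc (P * S)⁻¹ * J = (P * S)⁻¹ * (J * (P * S)) * (P * S)⁻¹ := by
          rw [Matrix.mul_assoc, Matrix.mul_assoc, Matrix.mul_nonsing_inv _ hTdet, Matrix.mul_one]
      _ = J * (P * S)⁻¹ := by
          rw [← hTJ.eq, ← Matrix.mul_assoc, Matrix.nonsing_inv_mul _ hTdet, Matrix.one_mul]
  refine ⟨1 + S * ((x - 1) • ((P * S)⁻¹ * P)), ?_, ?_⟩
  · refine (Commute.one_left N).add_left ?_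
    rw [Matrix.mul_smul]
    refine Commute.smul_left ?_ _
    change S * ((P * S)⁻¹ * P) * N = N * (S * ((P * S)⁻¹ * P))
    rw [Matrix.mul_assoc, Matrix.mul_assoc, hPN, ← Matrix.mul_assoc _ J, hTiJ, ← Matrix.mul_assoc N,
      hNS]
    simp only [Matrix.mul_assoc]
  · rw [Matrix.det_one_add_mul_comm, Matrix.smul_mul, Matrix.mul_assoc,
      Matrix.nonsing_inv_mul _ hTdet]
    have : (1 : Matrix (Fin l) (Fin l) F) + (x - 1) • 1 = x • 1 := by
      rw [sub_smul, one_smul]; abel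
    rw [this, Matrix.det_smul, Matrix.det_one, mul_one, Fintype.card_fin]

theorem Subgroup.pow_multiset_gcd_mem {G : Type*} [Group G] (H : Subgroup G) (y : G)
    (S : Multiset ℕ) (h : ∀ i ∈ S, y ^ i ∈ H) : y ^ S.gcd ∈ H := by
  induction S using Multiset.induction_on with
  | empty => simp
  | cons a S ih =>
    have ha := h a (Multiset.mem_cons_self a S)
    have hS := ih fun i hi => h i (Multiset.mem_cons_of_mem hi)
    rw [Multiset.gcd_cons, ← zpow_natCast]
    change y ^ ((Nat.gcd a S.gcd : ℕ) : ℤ) ∈ H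
    rw [Nat.gcd_eq_gcd_ab, zpow_add, zpow_mul, zpow_mul, zpow_natCast, zpow_natCast]
    exact H.mul_mem (H.zpow_mem ha _) (H.zpow_mem hS _)


/-- determinant computation used in Proposition 4.6 of the paper.
Let `F` be a finite field with `Q` elements and `u ∈ GL_m(F)` unipotent with Jordan type
`λ = (λ₁ ≥ … ≥ λ_r)`, recorded as a multiset `Λ` of positive parts summing to `m` such that
for each `k ≥ 1` the number of parts `≥ k` equals `rank (u-1)^(k-1) - rank (u-1)^k`.
Set `d = gcd(Q - 1, λ₁, …, λ_r)`.  Then the image of the centralizer of `u` in `GL_m(F)`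
under the determinant equals `{x^d : x ∈ F^×}`. -/
theorem stmt10 {Q m : ℕ} (F : Type*) [Field F] [Fintype F] [DecidableEq F]
    (hQ : Fintype.card F = Q) (hm : 1 ≤ m)
    (u : GL (Fin m) F)
    (hu : IsNilpotent ((u : Matrix (Fin m) (Fin m) F) - 1))
    (Λ : Multiset ℕ)
    (hpos : ∀ i ∈ Λ, 0 < i)
    (hsum : Λ.sum = m)
    (hrank : ∀ k : ℕ, 1 ≤ k →
      (Λ.filter (fun i => k ≤ i)).card =
        (((u : Matrix (Fin m) (Fin m) F) - 1) ^ (k - 1)).rank -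
          (((u : Matrix (Fin m) (Fin m) F) - 1) ^ k).rank) :
    (fun g : GL (Fin m) F => (g : Matrix (Fin m) (Fin m) F).det) ''
        {g : GL (Fin m) F | g * u = u * g}
      = {x : F | ∃ y : Fˣ, x = (y : F) ^ ((Q - 1) ::ₘ Λ).gcd} := by
  set N : Matrix (Fin m) (Fin m) F := (u : Matrix (Fin m) (Fin m) F) - 1 with hN
  let f : (Fin m → F) →ₗ[F] (Fin m → F) := Matrix.toLin' N
  have hfin : ∀ k, Module.finrank F (LinearMap.range (f ^ k)) = (N ^ k).rank := by
    intro k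
    rw [← Matrix.toLin'_pow]
    rfl
  have hcard : ∀ k, Module.finrank F
      (LinearMap.ker f ⊓ LinearMap.range (f ^ k) : Submodule F (Fin m → F)) =
        (Λ.filter (fun i => k + 1 ≤ i)).card := by
    intro k
    have h := f.finrank_ker_inf_add_finrank_map (LinearMap.range (f ^ k))
    rw [LinearMap.map_range_pow, hfin, hfin] at h
    rw [hrank (k + 1) (by omega), Nat.add_sub_cancel]
    omega
  have hanti : ∀ k, LinearMap.ker f ⊓ LinearMap.range (f ^ (k + 1)) ≤
      LinearMap.ker f ⊓ LinearMap.range (f ^ k) := by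
    intro k
    refine inf_le_inf_left _ ?_
    rw [pow_succ, Module.End.mul_eq_comp]
    exact LinearMap.range_comp_le_range _ _
  have hcomm : ∀ g : GL (Fin m) F, g * u = u * g ↔
      Commute (g : Matrix (Fin m) (Fin m) F) N := by
    intro g
    rw [Units.ext_iff, Units.val_mul, Units.val_mul, hN]
    constructor
    · intro h
      exact Commute.sub_right h (Commute.one_right _)
    · intro h
      have := h.add_right (Commute.one_right _)
      rwa [sub_add_cancel] at this
  ext x
  constructor
  · rintro ⟨g, hg, rfl⟩
    have hd : 0 < ((Q - 1) ::ₘ Λ).gcd := by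
      refine Nat.pos_of_ne_zero fun h0 => ?_
      have hz := (Multiset.gcd_eq_zero_iff _).1 h0
      have : Λ.sum = 0 := Multiset.sum_eq_zero fun i hi => hz i (Multiset.mem_cons_of_mem hi)
      omega
    have hfn : IsNilpotent f := by
      obtain ⟨n, hn⟩ := hu
      exact ⟨n, by rw [← Matrix.toLin'_pow, hn, map_zero]⟩
    have hfg : Commute f (Matrix.toLin' (g : Matrix (Fin m) (Fin m) F)) := by
      have h := ((hcomm g).1 hg).eq
      change _ ∘ₗ _ = _ ∘ₗ _
      rw [← Matrix.toLin'_mul, ← Matrix.toLin'_mul, h]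
    obtain ⟨y, hy⟩ := LinearMap.exists_det_eq_pow_of_commute f _ hfn hfg hd (by
      intro k hk
      refine (Submodule.eq_of_le_of_finrank_eq (hanti k) ?_).symm
      rw [hcard, hcard]
      congr 1
      refine Multiset.filter_congr fun i hi => ?_
      have : i ≠ k + 1 := by
        rintro rfl
        exact hk (Multiset.gcd_dvd (Multiset.mem_cons_of_mem hi))
      omega)
    rw [LinearMap.det_toLin'] at hy
    have hy0 : y ≠ 0 := by
      rintro rfl
      rw [zero_pow hd.ne'] at hy
      exact ((Matrix.isUnit_iff_isUnit_det _).1 g.isUnit).ne_zero hy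
    exact ⟨Units.mk0 y hy0, hy⟩
  · rintro ⟨y, rfl⟩
    let H : Subgroup Fˣ := (Subgroup.centralizer {u}).map Matrix.GeneralLinearGroup.det
    have hmem : y ^ ((Q - 1) ::ₘ Λ).gcd ∈ H := by
      refine H.pow_multiset_gcd_mem y _ fun l hl => ?_
      rcases Multiset.mem_cons.1 hl with rfl | hl
      · rw [← hQ, ← Fintype.card_units, pow_card_eq_one]
        exact H.one_mem
      obtain ⟨k, rfl⟩ : ∃ k, l = k + 1 := ⟨l - 1, by have := hpos l hl; omega⟩
      have hlt : ¬ LinearMap.ker f ⊓ LinearMap.range (f ^ k) ≤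
          LinearMap.ker f ⊓ LinearMap.range (f ^ (k + 1)) := by
        intro hle
        have h1 := hcard k
        rw [le_antisymm hle (hanti k), hcard] at h1
        have h2 : Λ.filter (fun i => k + 1 + 1 ≤ i) = Λ.filter (fun i => k + 1 ≤ i) :=
          Multiset.eq_of_le_of_card_le
            (Multiset.monotone_filter_right Λ fun i hi => by omega) h1.ge
        have h3 : k + 1 ∈ Λ.filter (fun i => k + 1 + 1 ≤ i) := by
          rw [h2]
          exact Multiset.mem_filter.2 ⟨hl, le_rfl⟩
        have := (Multiset.mem_filter.1 h3).2
        omega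
      obtain ⟨v, ⟨hvk, w, rfl⟩, hv⟩ := SetLike.not_le_iff_exists.1 hlt
      have hv' : (f ^ k) w ∉ LinearMap.range (f ^ (k + 1)) := fun h => hv ⟨hvk, h⟩
      obtain ⟨ψ, hψ, hψ'⟩ := Submodule.exists_le_ker_of_notMem hv'
      let φ : Fin m → F := fun i => ψ fun j => if i = j then 1 else 0
      have hφ : ∀ z, φ ⬝ᵥ z = ψ z := by
        intro z
        rw [LinearMap.pi_apply_eq_sum_univ ψ z]
        simp only [dotProduct, φ, smul_eq_mul, mul_comm]
      have hpow : ∀ n z, (N ^ n).mulVec z = (f ^ n) z := by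
        intro n z
        rw [← Matrix.toLin'_pow, Matrix.toLin'_apply]
      obtain ⟨g, hg, hgdet⟩ := Matrix.exists_commute_det_eq_pow N (k + 1) w φ
        (by rw [hpow, pow_succ']; exact hvk)
        (by
          refine dotProduct_eq_zero _ fun z => ?_
          rw [← Matrix.dotProduct_mulVec, hφ, hpow]
          exact hψ' ⟨z, rfl⟩)
        (by rw [hφ, Nat.add_sub_cancel, hpow]; exact hψ) (y : F)
      have hg0 : g.det ≠ 0 := by rw [hgdet]; exact pow_ne_zero _ y.ne_zero
      refine ⟨Matrix.GeneralLinearGroup.mkOfDetNeZero g hg0, ?_, ?_⟩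
      · refine Subgroup.mem_centralizer_singleton_iff.2 ?_
        exact (hcomm _).2 hg
      · ext
        rw [Units.val_pow_eq_pow_val]
        exact hgdet
    obtain ⟨g, hg, hgy⟩ := hmem
    refine ⟨g, Subgroup.mem_centralizer_singleton_iff.1 hg, ?_⟩
    have := congrArg Units.val hgy
    rwa [Units.val_pow_eq_pow_val] at this
end

section
/- Let s, u ∈ GU_n(q) be commuting elements with s of order coprime to p (semisimple) and u unipotent. For each eigenvalue ξ ∈ K of s, let λ^ξ be the Jordan type of the restriction of u to the eigenspace ker(s − ξ) ⊆ K^n. Let d be the greatest common divisor of q + 1 together with all the parts of all the partitions λ^ξ, where ξ ranges over the eigenvalues of s. Then the image under the determinant of the centralizer of su in GU_n(q) equals the unique subgroup of index d of μ_{q+1}, namely {x ∈ 𝔽_{q²}^× : x^{(q+1)/d} = 1}. -/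
open Module Matrix

/-- The permutation matrix `w₀` of the permutation `(1 n)(2 (n-1))⋯` of `{1, …, n}`. -/
def w0Mat (n : ℕ) (R : Type*) [CommRing R] : Matrix (Fin n) (Fin n) R :=
  Matrix.of fun i j => if j = Fin.rev i then 1 else 0

/-- Membership in the finite general unitary group
`GU_n(q) = {g ∈ GL_n(𝔽_{q²}) : w₀ · ((g^{(q)})ᵀ)⁻¹ · w₀ = g}`, where `g^{(q)}` is obtained
from `g` by raising every entry to the `q`-th power. -/
def IsGU {n : ℕ} (q : ℕ) {F2 : Type*} [Field F2] [Fintype F2] (g : GL (Fin n) F2) : Prop :=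
  w0Mat n F2 * ((((g : Matrix (Fin n) (Fin n) F2).map (· ^ q))ᵀ)⁻¹) * w0Mat n F2
    = (g : Matrix (Fin n) (Fin n) F2)

section DetOn

variable {F V U : Type*} [Field F] [AddCommGroup V] [Module F V] [AddCommGroup U] [Module F U]

open Classical in
/-- The determinant of `g` restricted to an invariant submodule `W` (and `1` if `W` is not
invariant). -/
noncomputable def detOn (g : End F V) (W : Submodule F V) : F :=
  if h : ∀ x ∈ W, g x ∈ W then LinearMap.det (g.restrict h) else 1

theorem detOn_eq {g : End F V} {W : Submodule F V} (h : ∀ x ∈ W, g x ∈ W) :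
    detOn g W = LinearMap.det (g.restrict h) :=
  dif_pos h

theorem detOn_range {g : End F V} {e : U →ₗ[F] V} (he : Function.Injective e) {a : End F U}
    (h : ∀ x, g (e x) = e (a x)) : detOn g (LinearMap.range e) = LinearMap.det a := by
  have hinv : ∀ x ∈ LinearMap.range e, g x ∈ LinearMap.range e := by
    rintro _ ⟨x, rfl⟩
    exact ⟨a x, (h x).symm⟩
  rw [detOn_eq hinv, ← LinearMap.det_conj a (LinearEquiv.ofInjective e he)]
  congr 1
  ext ⟨_, x, rfl⟩
  have : (⟨e x, x, rfl⟩ : LinearMap.range e) = LinearEquiv.ofInjective e he x := rfl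
  simp [this, h]

theorem detOn_top (g : End F V) : detOn g ⊤ = LinearMap.det g := by
  have := detOn_range (g := g) (e := LinearMap.id) Function.injective_id (a := g) (fun _ => rfl)
  rwa [LinearMap.range_id] at this

theorem detOn_bot (g : End F V) : detOn g ⊥ = 1 := by
  rw [detOn_eq (by simp)]
  exact LinearMap.det_eq_one_of_subsingleton _

theorem detOn_eq_one {g : End F V} {W : Submodule F V} (h : ∀ x ∈ W, g x = x) :
    detOn g W = 1 := by
  rw [detOn_eq (fun x hx => (h x hx).symm ▸ hx)]
  convert LinearMap.det_id
  ext x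
  simp [h x x.2]

theorem detOn_sup [FiniteDimensional F V] {g : End F V} {W W' : Submodule F V}
    (hd : Disjoint W W')
    (h : ∀ x ∈ W, g x ∈ W) (h' : ∀ x ∈ W', g x ∈ W') :
    detOn g (W ⊔ W') = detOn g W * detOn g W' := by
  have hinj : Function.Injective (W.subtype.coprod W'.subtype) := by
    rw [← LinearMap.ker_eq_bot, LinearMap.ker_coprod_of_disjoint_range]
    · simp
    · simpa using hd
  have := detOn_range (g := g) hinj (a := (g.restrict h).prodMap (g.restrict h'))
    (fun x => by simp)
  rw [LinearMap.range_coprod] at this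
  simpa [LinearMap.det_prodMap, ← detOn_eq] using this

theorem detOn_eq_mul [FiniteDimensional F V] {g N : End F V} (hgN : Commute g N)
    {W : Submodule F V}
    (h : ∀ x ∈ W, g x ∈ W) :
    detOn g W = detOn g (W ⊓ LinearMap.ker N) * detOn g (W.map N) := by
  have hc : ∀ x, g (N x) = N (g x) := fun x => LinearMap.congr_fun hgN.eq x
  set f : W →ₗ[F] V := N.domRestrict W with hf
  have hK : LinearMap.ker f ≤ (LinearMap.ker f).comap (g.restrict h) := by
    intro x hx
    simp only [hf, LinearMap.mem_ker, LinearMap.domRestrict_apply, Submodule.mem_comap,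
      LinearMap.coe_restrict_apply] at hx ⊢
    rw [← hc, hx, map_zero]
  rw [detOn_eq h, LinearMap.det_eq_det_mul_det (LinearMap.ker f) _ hK]
  congr 1
  · have := detOn_range (g := g) (e := W.subtype ∘ₗ (LinearMap.ker f).subtype)
      (W.injective_subtype.comp (LinearMap.ker f).injective_subtype)
      (a := (g.restrict h).restrict hK) (fun x => rfl)
    rw [← this]
    congr 1
    ext x
    simp [hf, LinearMap.mem_ker, and_comm]
  · have := detOn_range (g := g) (e := (LinearMap.ker f).liftQ f le_rfl)
      (LinearMap.ker_eq_bot.1 (Submodule.ker_liftQ_eq_bot _ _ _ le_rfl))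
      (a := (LinearMap.ker f).mapQ _ _ hK) (fun x => by
        induction x using Submodule.Quotient.induction_on with
        | H x => simp [hf, hc])
    rw [← this]
    congr 1
    rw [Submodule.range_liftQ, hf, LinearMap.range_domRestrict]

end DetOn

section Sesquilinear

variable {F V : Type*} [Field F] [StarRing F] [AddCommGroup V] [Module F V]

theorem star_det_of_adjoint [FiniteDimensional F V] (B : V →ₗ⋆[F] V →ₗ[F] F)
    (hB : ∀ y, (∀ x, B x y = 0) → y = 0) {a a' : End F V}
    (h : ∀ x y, B (a x) y = B x (a' y)) : star (LinearMap.det a) = LinearMap.det a' := by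
  classical
  set b := Module.finBasis F V
  set E : Matrix _ _ F := Matrix.of fun i j => B (b i) (b j) with hE
  have hdet : E.det ≠ 0 := by
    intro h0
    obtain ⟨c, hc, hc0⟩ := Matrix.exists_mulVec_eq_zero_iff.2 h0
    apply hc
    have hy : ∑ j, c j • b j = 0 := by
      apply hB
      intro x
      have hlin : ∀ i, B (b i) (∑ j, c j • b j) = 0 := by
        intro i
        have := congrFun hc0 i
        simpa [hE, Matrix.mulVec, dotProduct, mul_comm] using this
      rw [← b.sum_repr x]
      simp [hlin, LinearMap.sum_apply, -Basis.sum_repr, -map_sum, map_sum B]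
    funext j
    exact Fintype.linearIndependent_iff.1 b.linearIndependent c hy j
  have hmat : (LinearMap.toMatrix b b a)ᴴ * E = E * LinearMap.toMatrix b b a' := by
    ext i j
    have := h (b i) (b j)
    rw [← b.sum_repr (a (b i)), ← b.sum_repr (a' (b j))] at this
    simpa [Matrix.mul_apply, LinearMap.toMatrix_apply, hE, LinearMap.sum_apply, -Basis.sum_repr,
      mul_comm, starRingEnd_apply] using this
  have := congrArg Matrix.det hmat
  rw [Matrix.det_mul, Matrix.det_mul, Matrix.det_conjTranspose, LinearMap.det_toMatrix,
    LinearMap.det_toMatrix, mul_comm] at this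
  exact mul_left_cancel₀ hdet this

variable {h : V →ₗ⋆[F] V →ₗ[F] F}

theorem star_detOn_of_adjoint [FiniteDimensional F V] {W : Submodule F V}
    (hW : ∀ y ∈ W, (∀ x ∈ W, h x y = 0) → y = 0) {a a' : End F V}
    (haW : ∀ x ∈ W, a x ∈ W) (haW' : ∀ x ∈ W, a' x ∈ W)
    (ha : ∀ x y, h (a x) y = h x (a' y)) : star (detOn a W) = detOn a' W := by
  rw [detOn_eq haW, detOn_eq haW']
  refine star_det_of_adjoint (h.domRestrict₁₂ W W) ?_ ?_
  · rintro ⟨y, hy⟩ hxy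
    exact Subtype.ext (hW y hy fun x hx => hxy ⟨x, hx⟩)
  · intro x y
    exact ha x y

theorem star_detOn_range_mul_self [FiniteDimensional F V]
    (hnd : ∀ y, (∀ x, h x y = 0) → y = 0) {M M' g : End F V}
    (hM : ∀ x y, h (M x) y = h x (M' y)) (hker : ∀ t, M' t = 0 ↔ M t = 0)
    (hg : ∀ x y, h (g x) (g y) = h x y) (hgM : Commute g M) :
    star (detOn g (LinearMap.range M)) * detOn g (LinearMap.range M) = 1 := by
  have hc : ∀ x, g (M x) = M (g x) := fun x => LinearMap.congr_fun hgM.eq x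
  obtain ⟨R, hR⟩ := LinearMap.exists_rightInverse_of_surjective M.rangeRestrict
    (LinearMap.range_eq_top.2 M.surjective_rangeRestrict)
  have hR' : ∀ x : LinearMap.range M, M (R x) = x := fun x =>
    congrArg Subtype.val (LinearMap.congr_fun hR x)
  have hinv : ∀ x ∈ LinearMap.range M, g x ∈ LinearMap.range M := by
    rintro _ ⟨x, rfl⟩
    exact ⟨g x, (hc x).symm⟩
  have hginj : Function.Injective g := by
    rw [injective_iff_map_eq_zero]
    intro y hy
    refine hnd y fun x => ?_
    rw [← hg, hy, map_zero]
  rw [detOn_eq hinv]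
  set a := g.restrict hinv with ha
  have hainj : Function.Injective a := fun x y hxy =>
    Subtype.ext (hginj (congrArg Subtype.val hxy))
  set e := LinearEquiv.ofInjectiveEndo a hainj with he
  have hae : ∀ y, a (e.symm y) = y := fun y => e.apply_symm_apply y
  have key := star_det_of_adjoint ((h.comp (LinearMap.range M).subtype).compl₂ R)
    (a := a) (a' := (e.symm : End F (LinearMap.range M))) ?_ ?_
  · rw [key]
    have : (e.symm : End F (LinearMap.range M)) * a = 1 := by
      ext x
      simp only [Module.End.mul_apply, Module.End.one_apply]
      exact congrArg Subtype.val (e.symm_apply_apply x)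
    rw [← map_mul, this, map_one]
  · intro y hy
    have h0 : M' (R y) = 0 := by
      refine hnd _ fun z => ?_
      rw [← hM]
      exact hy ⟨M z, z, rfl⟩
    rw [hker, hR'] at h0
    exact Subtype.ext h0
  · rintro ⟨_, x, rfl⟩ y
    obtain ⟨z, rfl⟩ : ∃ z, a z = y := ⟨_, hae y⟩
    have hz : (e.symm : End F (LinearMap.range M)) (a z) = z := e.symm_apply_apply z
    have h1 : M' (R (a z) - g (R z)) = 0 := by
      rw [hker, map_sub, hR', ← hc, hR', ha]
      simp
    change h (g (M x)) (R (a z)) = h (M x) (R ((e.symm : End F (LinearMap.range M)) (a z)))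
    rw [hz, ← sub_eq_zero, ← hg (M x), ← map_sub, hc, hM, h1, map_zero]

/-- An isometry commuting with `x`, built from a normal operator `b` on a nondegenerate
subspace. -/
theorem exists_isometry_of_normal [Finite F] [FiniteDimensional F V]
    (hh : ∀ x y, h x y = star (h y x))
    {W : Submodule F V} (hW : ∀ y ∈ W, (∀ x ∈ W, h x y = 0) → y = 0) {b b' x : End F V}
    (hb : ∀ v w, h (b v) w = h v (b' w)) (hbb' : Commute b b')
    (hx : ∀ v w, h (x v) (x w) = h v w) (hbx : Commute b x) (hbx' : Commute b' x)
    (hbW : ∀ v ∈ W, b v ∈ W) (hbW' : ∀ v ∈ W, b' v ∈ W) (hxW : ∀ v ∈ W, x v ∈ W)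
    (hinj : ∀ v ∈ W, b v = 0 → v = 0) :
    ∃ g : End F V, (∀ v w, h (g v) (g w) = h v w) ∧ Commute g x ∧
      LinearMap.det g * star (detOn b W) = detOn b W := by
  classical
  have hsymm : ∀ v w, h v w = 0 → h w v = 0 := fun v w hvw => by rw [hh, hvw, star_zero]
  let Wp : Submodule F V :=
    { carrier := {y | ∀ w ∈ W, h w y = 0}
      add_mem' := fun ha hb w hw => by rw [map_add, ha w hw, hb w hw, add_zero]
      zero_mem' := fun w _ => map_zero _
      smul_mem' := fun c y hy w hw => by rw [map_smul, hy w hw, smul_zero] }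
  have hdisj : Disjoint W Wp := by
    rw [Submodule.disjoint_def]
    intro y hy hy'
    exact hW y hy hy'
  have hcod : W ⊔ Wp = ⊤ := by
    rw [eq_top_iff]
    intro y _
    let θ : V → Dual F W := fun y => (h y).domRestrict W
    have hinjθ : Function.Injective fun w : W => θ w := by
      intro w w' hww
      rw [← sub_eq_zero]
      refine Subtype.ext (hW _ (w - w').2 fun v hv => hsymm _ _ ?_)
      have := LinearMap.congr_fun hww ⟨v, hv⟩
      simpa [θ, sub_eq_zero] using this
    have hfin : Finite W := Module.finite_of_finite F
    have hsurj := (Finite.injective_iff_surjective_of_equiv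
      (LinearEquiv.ofFinrankEq W (Dual F W) Subspace.dual_finrank_eq.symm).toEquiv).1 hinjθ
    obtain ⟨w, hw⟩ := hsurj (θ y)
    refine Submodule.mem_sup.2 ⟨w, w.2, y - w, fun v hv => hsymm _ _ ?_, by abel⟩
    have := LinearMap.congr_fun hw ⟨v, hv⟩
    simp only [θ, LinearMap.domRestrict_apply] at this
    simp [this]
  have hcompl : IsCompl W Wp := ⟨hdisj, codisjoint_iff.2 hcod⟩
  have hbinj' : ∀ v ∈ W, b' v = 0 → v = 0 := by
    intro v hv hv0
    have hs : Function.Surjective (b.restrict hbW) := by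
      rw [← LinearMap.injective_iff_surjective, injective_iff_map_eq_zero]
      exact fun y hy => Subtype.ext (hinj y y.2 (congrArg Subtype.val hy))
    refine hW v hv fun w hw => ?_
    obtain ⟨t, ht⟩ := hs ⟨w, hw⟩
    have ht' : b t = w := congrArg Subtype.val ht
    rw [← ht', hb, hv0, map_zero]
  have hinj' : Function.Injective (b'.restrict hbW') := by
    rw [injective_iff_map_eq_zero]
    exact fun y hy => Subtype.ext (hbinj' y y.2 (congrArg Subtype.val hy))
  set e := LinearEquiv.ofInjectiveEndo _ hinj' with he
  have hsurj' : ∀ v ∈ W, ∃ t ∈ W, b' t = v := fun v hv =>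
    ⟨e.symm ⟨v, hv⟩, (e.symm ⟨v, hv⟩).2, congrArg Subtype.val (e.apply_symm_apply ⟨v, hv⟩)⟩
  have hsurjx : ∀ v ∈ W, ∃ t ∈ W, x t = v := by
    have hs : Function.Surjective (x.restrict hxW) := by
      rw [← LinearMap.injective_iff_surjective, injective_iff_map_eq_zero]
      refine fun y hy => Subtype.ext (hW y y.2 fun w _ => ?_)
      have hy' : x y = 0 := congrArg Subtype.val hy
      rw [← hx, hy', map_zero]
    intro v hv
    obtain ⟨t, ht⟩ := hs ⟨v, hv⟩
    exact ⟨t, t.2, congrArg Subtype.val ht⟩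
  let g : End F V := LinearMap.ofIsCompl hcompl
    (W.subtype ∘ₗ (b.restrict hbW) ∘ₗ (e.symm : W →ₗ[F] W)) Wp.subtype
  have hgW : ∀ t ∈ W, g (b' t) = b t := by
    intro t ht
    have h1 : (⟨b' t, hbW' t ht⟩ : W) = e ⟨t, ht⟩ := rfl
    have := LinearMap.ofIsCompl_apply_left hcompl
      (φ := W.subtype ∘ₗ (b.restrict hbW) ∘ₗ (e.symm : W →ₗ[F] W)) (ψ := Wp.subtype)
      ⟨b' t, hbW' t ht⟩
    rw [show g (b' t) = _ from this, h1]
    simp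
  have hgWp : ∀ t ∈ Wp, g t = t := fun t ht =>
    LinearMap.ofIsCompl_apply_right hcompl
      (φ := W.subtype ∘ₗ (b.restrict hbW) ∘ₗ (e.symm : W →ₗ[F] W)) (ψ := Wp.subtype) ⟨t, ht⟩
  have hxWp : ∀ t ∈ Wp, x t ∈ Wp := by
    intro t ht w hw
    obtain ⟨w', hw', rfl⟩ := hsurjx w hw
    rw [hx, ht w' hw']
  have hgbW : ∀ v ∈ W, g v ∈ W := by
    intro v hv
    obtain ⟨t, ht, rfl⟩ := hsurj' v hv
    rw [hgW t ht]
    exact hbW t ht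
  have hdec : ∀ v, ∃ t ∈ W, ∃ y ∈ Wp, b' t + y = v := by
    intro v
    obtain ⟨w, hw, y, hy, rfl⟩ := Submodule.mem_sup.1 (hcod ▸ Submodule.mem_top : v ∈ W ⊔ Wp)
    obtain ⟨t, ht, rfl⟩ := hsurj' w hw
    exact ⟨t, ht, y, hy, rfl⟩
  have hcx : ∀ t, b (x t) = x (b t) := fun t => LinearMap.congr_fun hbx.eq t
  have hcx' : ∀ t, b' (x t) = x (b' t) := fun t => LinearMap.congr_fun hbx'.eq t
  have hcb : ∀ t, b (b' t) = b' (b t) := fun t => LinearMap.congr_fun hbb'.eq t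
  refine ⟨g, ?_, ?_, ?_⟩
  · intro v w
    obtain ⟨t, ht, y, hy, rfl⟩ := hdec v
    obtain ⟨t', ht', y', hy', rfl⟩ := hdec w
    have e1 : h (b t) (b t') = h (b' t) (b' t') := by
      rw [hb, ← hcb, hh (b' t), ← hb, ← hh]
    simp only [map_add, LinearMap.add_apply, hgW t ht, hgW t' ht', hgWp y hy, hgWp y' hy',
      hy' _ (hbW t ht), hsymm _ _ (hy _ (hbW t' ht')), hy' _ (hbW' t ht),
      hsymm _ _ (hy _ (hbW' t' ht')), e1]
  · refine LinearMap.ext fun v => ?_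
    obtain ⟨t, ht, y, hy, rfl⟩ := hdec v
    simp only [Module.End.mul_apply, map_add, ← hcx', hgW _ (hxW t ht), hgWp _ (hxWp y hy),
      hgW t ht, hgWp y hy, hcx]
  · have h1 : LinearMap.det g = detOn g W := by
      rw [← detOn_top, ← hcod, detOn_sup hdisj hgbW (fun t ht => (hgWp t ht).symm ▸ ht),
        detOn_eq_one hgWp, mul_one]
    rw [h1, star_detOn_of_adjoint hW hbW hbW' hb, detOn_eq hgbW, detOn_eq hbW, detOn_eq hbW',
      ← map_mul]
    congr 1
    ext t
    exact hgW t t.2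

end Sesquilinear

section Cyclic

open Polynomial

variable {F V : Type*} [Field F] [AddCommGroup V] [Module F V]

/-- The submodule generated by `v` under the algebra generated by `s` and `N`. -/
noncomputable def cyclicSpan (s N : End F V) (v : V) : Submodule F V :=
  (Subalgebra.toSubmodule (Algebra.adjoin F {s, N})).map (LinearMap.applyₗ v)

/-- Every nonzero vector in the span of the `s`-orbit of `v` generates that span. -/
def IsSimpleVector (s : End F V) (v : V) : Prop :=
  ∀ a : F[X], aeval s a v = 0 ∨ ∃ c : F[X], aeval s c (aeval s a v) = v

variable {s N : End F V} {v : V}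

theorem mem_cyclicSpan {t : V} :
    t ∈ cyclicSpan s N v ↔ ∃ φ ∈ Algebra.adjoin F {s, N}, φ v = t := by
  simp [cyclicSpan]

theorem left_mem_adjoin_pair : s ∈ Algebra.adjoin F {s, N} :=
  Algebra.subset_adjoin (by simp)

theorem right_mem_adjoin_pair : N ∈ Algebra.adjoin F {s, N} :=
  Algebra.subset_adjoin (by simp)

theorem aeval_mem_adjoin_pair (a : F[X]) : aeval s a ∈ Algebra.adjoin F {s, N} :=
  Algebra.adjoin_mono (by simp) (aeval_mem_adjoin_singleton F s)

theorem apply_mem_cyclicSpan {φ : End F V} (hφ : φ ∈ Algebra.adjoin F {s, N}) {t : V}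
    (ht : t ∈ cyclicSpan s N v) : φ t ∈ cyclicSpan s N v := by
  obtain ⟨ψ, hψ, rfl⟩ := mem_cyclicSpan.1 ht
  exact mem_cyclicSpan.2 ⟨φ * ψ, mul_mem hφ hψ, rfl⟩

theorem commute_of_mem_adjoin_pair (h : Commute s N) {φ ψ : End F V}
    (hφ : φ ∈ Algebra.adjoin F {s, N}) (hψ : ψ ∈ Algebra.adjoin F {s, N}) : Commute φ ψ := by
  have hs : ∀ χ ∈ Algebra.adjoin F {s, N}, Commute s χ ∧ Commute N χ := by
    intro χ hχ
    constructor
    · refine Algebra.commute_of_mem_adjoin_of_forall_mem_commute hχ ?_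
      rintro _ (rfl | rfl)
      exacts [Commute.refl _, h]
    · refine Algebra.commute_of_mem_adjoin_of_forall_mem_commute hχ ?_
      rintro _ (rfl | rfl)
      exacts [h.symm, Commute.refl _]
  refine Algebra.commute_of_mem_adjoin_of_forall_mem_commute hψ ?_
  rintro _ (rfl | rfl)
  exacts [(hs _ hφ).1.symm, (hs _ hφ).2.symm]

theorem apply_eq_zero_of_mem_cyclicSpan (h : Commute s N) {φ : End F V}
    (hφ : φ ∈ Algebra.adjoin F {s, N}) (h0 : φ v = 0) {t : V} (ht : t ∈ cyclicSpan s N v) :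
    φ t = 0 := by
  obtain ⟨ψ, hψ, rfl⟩ := mem_cyclicSpan.1 ht
  have := LinearMap.congr_fun (commute_of_mem_adjoin_pair h hφ hψ).eq v
  simpa [h0] using this

theorem map_cyclicSpan (h : Commute s N) {φ : End F V} (hφ : φ ∈ Algebra.adjoin F {s, N}) :
    (cyclicSpan s N v).map φ = cyclicSpan s N (φ v) := by
  ext t
  simp only [Submodule.mem_map, mem_cyclicSpan]
  constructor
  · rintro ⟨_, ⟨ψ, hψ, rfl⟩, rfl⟩
    exact ⟨ψ, hψ, LinearMap.congr_fun (commute_of_mem_adjoin_pair h hψ hφ).eq v⟩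
  · rintro ⟨ψ, hψ, rfl⟩
    exact ⟨_, ⟨ψ, hψ, rfl⟩, LinearMap.congr_fun (commute_of_mem_adjoin_pair h hφ hψ).eq v⟩

theorem exists_eq_aeval_add_mul (h : Commute s N) {φ : End F V}
    (hφ : φ ∈ Algebra.adjoin F {s, N}) :
    ∃ a : F[X], ∃ ψ ∈ Algebra.adjoin F {s, N}, φ = aeval s a + N * ψ := by
  induction hφ using Algebra.adjoin_induction with
  | mem x hx =>
    rcases hx with rfl | rfl
    · exact ⟨X, 0, zero_mem _, by simp⟩
    · exact ⟨0, 1, one_mem _, by simp⟩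
  | algebraMap r => exact ⟨C r, 0, zero_mem _, by simp⟩
  | add x y _ _ hx hy =>
    obtain ⟨a, ψ, hψ, rfl⟩ := hx
    obtain ⟨b, χ, hχ, rfl⟩ := hy
    exact ⟨a + b, ψ + χ, add_mem hψ hχ, by rw [map_add, mul_add]; abel⟩
  | mul x y _ hy' hx hy =>
    obtain ⟨a, ψ, hψ, rfl⟩ := hx
    obtain ⟨b, χ, hχ, rfl⟩ := hy
    refine ⟨a * b, aeval s a * χ + ψ * (aeval s b + N * χ),
      add_mem (mul_mem (aeval_mem_adjoin_pair a) hχ) (mul_mem hψ hy'), ?_⟩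
    have hc := (commute_of_mem_adjoin_pair h (aeval_mem_adjoin_pair a)
      (right_mem_adjoin_pair (s := s) (N := N))).eq
    rw [map_mul, add_mul, mul_add, mul_add, mul_add, ← mul_assoc (aeval s a) N, hc]
    simp only [mul_assoc, mul_add]
    abel

theorem isSimpleVector_of_irreducible {f : F[X]} (hf : Irreducible f) (hv : aeval s f v = 0) :
    IsSimpleVector s v := by
  intro a
  rcases (hf.isCoprime_or_dvd a) with hc | ⟨b, rfl⟩
  · right
    obtain ⟨c, e, hce⟩ := hc
    refine ⟨e, ?_⟩
    have := LinearMap.congr_fun (congrArg (aeval s) hce) v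
    simpa [hv] using this
  · left
    rw [mul_comm, map_mul, Module.End.mul_apply, hv, map_zero]

theorem IsSimpleVector.exists_apply_eq (h : Commute s N) (hv : IsSimpleVector s v) {k : ℕ}
    (hk : (N ^ k) v = 0) {t : V} (ht : t ∈ cyclicSpan s N v) (ht0 : t ≠ 0) :
    ∃ c ∈ Algebra.adjoin F {s, N}, c t = (N ^ (k - 1)) v := by
  have key : ∀ j i, i + j = k → ∀ φ ∈ Algebra.adjoin F {s, N}, φ ((N ^ i) v) ≠ 0 →
      ∃ c ∈ Algebra.adjoin F {s, N}, c (φ ((N ^ i) v)) = (N ^ (k - 1)) v := by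
    intro j
    induction j with
    | zero =>
      rintro i rfl φ _ h0
      simp only [add_zero] at hk
      simp [hk] at h0
    | succ j ih =>
      intro i hi φ hφ h0
      obtain ⟨a, ψ, hψ, rfl⟩ := exists_eq_aeval_add_mul h hφ
      have hN : (N : End F V) ∈ Algebra.adjoin F {s, N} := right_mem_adjoin_pair
      have hca : ∀ m y, aeval s a ((N ^ m) y) = (N ^ m) (aeval s a y) := fun m =>
        LinearMap.congr_fun
          (commute_of_mem_adjoin_pair h (aeval_mem_adjoin_pair a) (pow_mem hN m)).eq
      have hcψ : ∀ m y, ψ ((N ^ m) y) = (N ^ m) (ψ y) := fun m =>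
        LinearMap.congr_fun (commute_of_mem_adjoin_pair h hψ (pow_mem hN m)).eq
      rcases hv a with ha | ⟨c, hc⟩
      · have e : (aeval s a + N * ψ) ((N ^ i) v) = ψ ((N ^ (i + 1)) v) := by
          rw [LinearMap.add_apply, hca, ha, map_zero, zero_add, Module.End.mul_apply, hcψ, hcψ,
            pow_succ', Module.End.mul_apply]
        rw [e] at h0 ⊢
        exact ih (i + 1) (by omega) ψ hψ h0
      · refine ⟨aeval s c * N ^ j, mul_mem (aeval_mem_adjoin_pair c) (pow_mem hN j), ?_⟩
        have hcc : ∀ m y, aeval s c ((N ^ m) y) = (N ^ m) (aeval s c y) := fun m =>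
          LinearMap.congr_fun
            (commute_of_mem_adjoin_pair h (aeval_mem_adjoin_pair c) (pow_mem hN m)).eq
        have e2 : (N ^ j) (N (ψ ((N ^ i) v))) = 0 := by
          rw [hcψ, ← Module.End.mul_apply, ← Module.End.mul_apply, ← pow_succ, ← pow_add,
            show j + 1 + i = k by omega, ← hcψ, hk, map_zero]
        rw [Module.End.mul_apply, LinearMap.add_apply, map_add, Module.End.mul_apply, e2,
          add_zero, hca, ← Module.End.mul_apply (N ^ j), ← pow_add, hcc, hc,
          show j + i = k - 1 by omega]
  obtain ⟨φ, hφ, rfl⟩ := mem_cyclicSpan.1 ht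
  exact key k 0 (by omega) φ hφ ht0

theorem IsSimpleVector.cyclicSpan_inf_ker (h : Commute s N) (hv : IsSimpleVector s v) {k : ℕ}
    (hk : (N ^ (k + 1)) v = 0) (hk' : (N ^ k) v ≠ 0) {i : ℕ} (hi : i ≤ k) :
    cyclicSpan s N ((N ^ i) v) ⊓ LinearMap.ker N = cyclicSpan s N ((N ^ k) v) := by
  have hN : (N : End F V) ∈ Algebra.adjoin F {s, N} := right_mem_adjoin_pair
  apply le_antisymm
  · have key : ∀ j i, i + j = k → ∀ φ ∈ Algebra.adjoin F {s, N}, N (φ ((N ^ i) v)) = 0 →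
        φ ((N ^ i) v) ∈ cyclicSpan s N ((N ^ k) v) := by
      intro j
      induction j with
      | zero =>
        rintro i rfl φ hφ _
        exact mem_cyclicSpan.2 ⟨φ, hφ, rfl⟩
      | succ j ih =>
        intro i hi φ hφ h0
        obtain ⟨a, ψ, hψ, rfl⟩ := exists_eq_aeval_add_mul h hφ
        have hca : ∀ m y, aeval s a ((N ^ m) y) = (N ^ m) (aeval s a y) := fun m =>
          LinearMap.congr_fun
            (commute_of_mem_adjoin_pair h (aeval_mem_adjoin_pair a) (pow_mem hN m)).eq
        have hcψ : ∀ m y, ψ ((N ^ m) y) = (N ^ m) (ψ y) := fun m =>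
          LinearMap.congr_fun (commute_of_mem_adjoin_pair h hψ (pow_mem hN m)).eq
        rcases hv a with ha | ⟨c, hc⟩
        · have e : (aeval s a + N * ψ) ((N ^ i) v) = ψ ((N ^ (i + 1)) v) := by
            rw [LinearMap.add_apply, hca, ha, map_zero, zero_add, Module.End.mul_apply, hcψ,
              hcψ, pow_succ', Module.End.mul_apply]
          rw [e] at h0 ⊢
          exact ih (i + 1) (by omega) ψ hψ h0
        · exfalso
          apply hk'
          have e1 := congrArg (N ^ j) h0
          have e2 : (N ^ (j + 1)) (N (ψ ((N ^ i) v))) = 0 := by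
            rw [hcψ, ← Module.End.mul_apply, ← Module.End.mul_apply, ← pow_succ, ← pow_add,
              show j + 1 + 1 + i = k + 1 by omega, ← hcψ, hk, map_zero]
          rw [map_zero, ← Module.End.mul_apply (N ^ j), ← pow_succ, LinearMap.add_apply, map_add,
            Module.End.mul_apply N, e2, add_zero, hca, ← Module.End.mul_apply (N ^ (j + 1)),
            ← pow_add, show j + 1 + i = k by omega] at e1
          have hcc : ∀ m y, aeval s c ((N ^ m) y) = (N ^ m) (aeval s c y) := fun m =>
            LinearMap.congr_fun
              (commute_of_mem_adjoin_pair h (aeval_mem_adjoin_pair c) (pow_mem hN m)).eq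
          rw [← hc, ← hcc, e1, map_zero]
    rintro t ⟨ht, ht0⟩
    obtain ⟨φ, hφ, rfl⟩ := mem_cyclicSpan.1 ht
    exact key (k - i) i (by omega) φ hφ ht0
  · intro t ht
    refine ⟨?_, ?_⟩
    · obtain ⟨φ, hφ, rfl⟩ := mem_cyclicSpan.1 ht
      refine mem_cyclicSpan.2 ⟨φ * N ^ (k - i), mul_mem hφ (pow_mem hN _), ?_⟩
      rw [Module.End.mul_apply, ← Module.End.mul_apply (N ^ _), ← pow_add,
        show k - i + i = k by omega]
    · change N t = 0
      refine apply_eq_zero_of_mem_cyclicSpan h hN ?_ ht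
      rwa [← Module.End.mul_apply, ← pow_succ']

theorem detOn_aeval_cyclicSpan_of_apply_eq_zero {f : F[X]} (hf : Irreducible f) (hm : f.Monic)
    (h : Commute s N) (hv : aeval s f v = 0) (hN : N v = 0) (hv0 : v ≠ 0) (P : F[X]) :
    detOn (aeval s P) (cyclicSpan s N v) = Algebra.norm F (AdjoinRoot.mk f P) := by
  set e : AdjoinRoot f →ₗ[F] V :=
    LinearMap.applyₗ v ∘ₗ (aeval s).toLinearMap ∘ₗ
      (AdjoinRoot.modByMonicHom hm) with he
  have hmk : ∀ Q, e (AdjoinRoot.mk f Q) = aeval s Q v := by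
    intro Q
    simp only [he, LinearMap.comp_apply, AdjoinRoot.modByMonicHom_mk]
    have := congrArg (fun R => aeval s R v) (modByMonic_add_div Q f)
    simp only [map_add, LinearMap.add_apply, mul_comm f, map_mul, Module.End.mul_apply, hv,
      map_zero, add_zero] at this
    exact this
  have hinj : Function.Injective e := by
    rw [injective_iff_map_eq_zero]
    intro x hx
    obtain ⟨Q, rfl⟩ := AdjoinRoot.mk_surjective x
    rw [hmk] at hx
    rcases hf.isCoprime_or_dvd Q with ⟨c, d, hcd⟩ | hd
    · exfalso
      apply hv0
      have := LinearMap.congr_fun (congrArg (aeval s) hcd) v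
      simpa [hv, hx] using this.symm
    · exact AdjoinRoot.mk_eq_zero.2 hd
  have hr : LinearMap.range e = cyclicSpan s N v := by
    ext t
    simp only [LinearMap.mem_range, mem_cyclicSpan]
    constructor
    · rintro ⟨x, rfl⟩
      obtain ⟨Q, rfl⟩ := AdjoinRoot.mk_surjective x
      exact ⟨_, aeval_mem_adjoin_pair Q, (hmk Q).symm⟩
    · rintro ⟨φ, hφ, rfl⟩
      obtain ⟨a, ψ, hψ, rfl⟩ := exists_eq_aeval_add_mul h hφ
      refine ⟨AdjoinRoot.mk f a, ?_⟩
      have hc := LinearMap.congr_fun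
        (commute_of_mem_adjoin_pair h hψ (right_mem_adjoin_pair (s := s) (N := N))).eq v
      simp only [Module.End.mul_apply, hN, map_zero] at hc
      rw [hmk, LinearMap.add_apply, Module.End.mul_apply, ← hc, add_zero]
  rw [← hr, Algebra.norm_apply]
  refine detOn_range hinj fun x => ?_
  obtain ⟨Q, rfl⟩ := AdjoinRoot.mk_surjective x
  change aeval s P (e (AdjoinRoot.mk f Q)) = e (AdjoinRoot.mk f P * AdjoinRoot.mk f Q)
  rw [← map_mul, hmk, hmk, map_mul, Module.End.mul_apply]

theorem detOn_aeval_cyclicSpan [FiniteDimensional F V] {f : F[X]} (hf : Irreducible f)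
    (hm : f.Monic) (h : Commute s N) (hv : aeval s f v = 0) {k : ℕ}
    (hk : (N ^ (k + 1)) v = 0) (hk' : (N ^ k) v ≠ 0) (P : F[X]) :
    detOn (aeval s P) (cyclicSpan s N v) = Algebra.norm F (AdjoinRoot.mk f P) ^ (k + 1) := by
  have hN : (N : End F V) ∈ Algebra.adjoin F {s, N} := right_mem_adjoin_pair
  have hfk : aeval s f ((N ^ k) v) = 0 := by
    have := LinearMap.congr_fun
      (commute_of_mem_adjoin_pair h (aeval_mem_adjoin_pair f) (pow_mem hN k)).eq v
    simpa [hv] using this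
  have key : ∀ j i, i + j = k + 1 → detOn (aeval s P) (cyclicSpan s N ((N ^ i) v)) =
      Algebra.norm F (AdjoinRoot.mk f P) ^ j := by
    intro j
    induction j with
    | zero =>
      intro i hi
      have : cyclicSpan s N ((N ^ i) v) = ⊥ := by
        rw [show i = k + 1 by omega, hk, eq_bot_iff]
        intro t ht
        obtain ⟨φ, -, rfl⟩ := mem_cyclicSpan.1 ht
        simp
      rw [this, detOn_bot, pow_zero]
    | succ j ih =>
      intro i hi
      rw [detOn_eq_mul (commute_of_mem_adjoin_pair h (aeval_mem_adjoin_pair P) hN)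
        (fun x hx => apply_mem_cyclicSpan (aeval_mem_adjoin_pair P) hx),
        (isSimpleVector_of_irreducible hf hv).cyclicSpan_inf_ker h hk hk' (by omega),
        map_cyclicSpan h hN, ← Module.End.mul_apply, ← pow_succ', ih (i + 1) (by omega),
        detOn_aeval_cyclicSpan_of_apply_eq_zero hf hm h hfk _ hk', pow_succ']
      rwa [← Module.End.mul_apply, ← pow_succ']
  exact key (k + 1) 0 (by omega)

end Cyclic

section Isometry

open Polynomial

theorem isCoprime_of_norm_mk_ne_zero {F : Type*} [Field F] {f P : F[X]} (hf : Irreducible f)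
    (hm : f.Monic) (hP : Algebra.norm F (AdjoinRoot.mk f P) ≠ 0) : IsCoprime f P := by
  have := Fact.mk hf
  have := hm.finite_adjoinRoot
  refine (hf.isCoprime_or_dvd P).resolve_right fun hd => hP ?_
  rw [AdjoinRoot.mk_eq_zero.2 hd, Algebra.norm_zero]

theorem exists_norm_mk_eq {F : Type*} [Field F] [Finite F] {f : F[X]} (hf : Irreducible f)
    (hm : f.Monic) (z : F) : ∃ P : F[X], Algebra.norm F (AdjoinRoot.mk f P) = z := by
  have := Fact.mk hf
  have := hm.finite_adjoinRoot
  have : Finite (AdjoinRoot f) := Module.finite_of_finite F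
  obtain ⟨x, hx⟩ := FiniteField.norm_surjective F (AdjoinRoot f) z
  obtain ⟨P, rfl⟩ := AdjoinRoot.mk_surjective x
  exact ⟨P, hx⟩

variable {F V : Type*} [Field F] [StarRing F] [AddCommGroup V] [Module F V]
  {h : V →ₗ⋆[F] V →ₗ[F] F}

theorem adjoint_symm (hh : ∀ x y, h x y = star (h y x)) {φ φ' : End F V}
    (hφ : ∀ x y, h (φ x) y = h x (φ' y)) (x y : V) : h (φ' x) y = h x (φ y) := by
  rw [hh, ← hφ, ← hh]

theorem adjoint_pow {φ φ' : End F V} (hφ : ∀ x y, h (φ x) y = h x (φ' y)) (k : ℕ) (x y : V) :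
    h ((φ ^ k) x) y = h x ((φ' ^ k) y) := by
  induction k generalizing x y with
  | zero => rfl
  | succ k ih =>
    rw [pow_succ, pow_succ', Module.End.mul_apply, Module.End.mul_apply, ih, hφ]

theorem exists_adjoint_of_mem_adjoin {S : Set (End F V)} {A : Subalgebra F (End F V)}
    (hS : ∀ φ ∈ S, ∃ φ' ∈ A, ∀ x y, h (φ x) y = h x (φ' y)) {φ : End F V}
    (hφ : φ ∈ Algebra.adjoin F S) : ∃ φ' ∈ A, ∀ x y, h (φ x) y = h x (φ' y) := by
  induction hφ using Algebra.adjoin_induction with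
  | mem x hx => exact hS x hx
  | algebraMap r =>
    refine ⟨algebraMap F _ (star r), A.algebraMap_mem _, fun x y => ?_⟩
    simp [Module.algebraMap_end_apply, starRingEnd_apply]
  | add a b _ _ ha hb =>
    obtain ⟨a', haA, ha⟩ := ha
    obtain ⟨b', hbA, hb⟩ := hb
    exact ⟨a' + b', add_mem haA hbA, fun x y => by simp [ha, hb]⟩
  | mul a b _ _ ha hb =>
    obtain ⟨a', haA, ha⟩ := ha
    obtain ⟨b', hbA, hb⟩ := hb
    exact ⟨b' * a', mul_mem hbA haA, fun x y => by simp [ha, hb]⟩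

theorem exists_adjoint_aeval {s : End F V} {σ : F[X]}
    (hs : ∀ x y, h (s x) y = h x (aeval s σ y)) (a : F[X]) :
    ∃ a' : F[X], ∀ x y, h (aeval s a x) y = h x (aeval s a' y) := by
  obtain ⟨φ, hφ, hadj⟩ := exists_adjoint_of_mem_adjoin (S := {s}) (A := Algebra.adjoin F {s})
    (h := h) (fun φ hφ => ⟨_, aeval_mem_adjoin_singleton F s (p := σ), by
      rw [Set.mem_singleton_iff.1 hφ]; exact hs⟩) (aeval_mem_adjoin_singleton F s (p := a))
  rw [Algebra.adjoin_singleton_eq_range_aeval] at hφ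
  obtain ⟨a', rfl⟩ := hφ
  exact ⟨a', hadj⟩

theorem exists_apply_eq_of_nondegenerate [Finite F] [FiniteDimensional F V]
    (hh : ∀ x y, h x y = star (h y x)) (hnd : ∀ y, (∀ x, h x y = 0) → y = 0) (ℓ : Dual F V) :
    ∃ w, h w = ℓ := by
  have hinj : Function.Injective fun w => h w := by
    intro w w' hww
    rw [← sub_eq_zero]
    refine hnd _ fun x => ?_
    have := LinearMap.congr_fun hww x
    rw [hh, map_sub, LinearMap.sub_apply]
    simp [this]
  have hfin : Finite V := Module.finite_of_finite F
  exact (Finite.injective_iff_surjective_of_equiv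
      (LinearEquiv.ofFinrankEq V (Dual F V) Subspace.dual_finrank_eq.symm).toEquiv).1 hinj ℓ

variable {s N : End F V}

theorem IsSimpleVector.exists_pairing_ne_zero (hh : ∀ x y, h x y = star (h y x))
    (hsN : Commute s N)
    (hadj : ∀ φ ∈ Algebra.adjoin F {s, N}, ∃ φ' ∈ Algebra.adjoin F {s, N},
      ∀ x y, h (φ x) y = h x (φ' y)) {v w : V} (hv : IsSimpleVector s v) {k : ℕ}
    (hk : (N ^ (k + 1)) v = 0) (hwv : h w ((N ^ k) v) ≠ 0) {t : V} (ht : t ∈ cyclicSpan s N v)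
    (ht0 : t ≠ 0) : ∃ x ∈ cyclicSpan s N w, h x t ≠ 0 := by
  obtain ⟨c, hc, hct⟩ := hv.exists_apply_eq hsN hk ht ht0
  obtain ⟨c', hc', hcc⟩ := hadj c hc
  refine ⟨c' w, mem_cyclicSpan.2 ⟨c', hc', rfl⟩, ?_⟩
  rw [adjoint_symm hh hcc, hct]
  exact hwv

theorem exists_isometry_of_cyclicSpan [Finite F] [FiniteDimensional F V]
    (hh : ∀ x y, h x y = star (h y x)) (hsN : Commute s N)
    (hadj : ∀ φ ∈ Algebra.adjoin F {s, N}, ∃ φ' ∈ Algebra.adjoin F {s, N},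
      ∀ x y, h (φ x) y = h x (φ' y))
    {x : End F V} (hxA : x ∈ Algebra.adjoin F {s, N}) (hx : ∀ v w, h (x v) (x w) = h v w)
    {f P : F[X]} (hf : Irreducible f) (hm : f.Monic) {z : F}
    (hP : Algebra.norm F (AdjoinRoot.mk f P) = z) (hz : z ≠ 0) {v : V} (hv : aeval s f v = 0)
    {k : ℕ} (hk : (N ^ (k + 1)) v = 0) (hvv : h v ((N ^ k) v) ≠ 0) :
    ∃ g : End F V, (∀ v w, h (g v) (g w) = h v w) ∧ Commute g x ∧
      LinearMap.det g * star (z ^ (k + 1)) = z ^ (k + 1) := by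
  have hsv := isSimpleVector_of_irreducible hf hv
  have hk' : (N ^ k) v ≠ 0 := fun h0 => hvv (by rw [h0, map_zero])
  have hPA := aeval_mem_adjoin_pair (s := s) (N := N) P
  obtain ⟨b', hb'A, hb'⟩ := hadj _ hPA
  rw [← hP, ← detOn_aeval_cyclicSpan hf hm hsN hv hk hk' P]
  refine exists_isometry_of_normal hh ?_ hb' (commute_of_mem_adjoin_pair hsN hPA hb'A) hx
    (commute_of_mem_adjoin_pair hsN hPA hxA) (commute_of_mem_adjoin_pair hsN hb'A hxA)
    (fun _ => apply_mem_cyclicSpan hPA) (fun _ => apply_mem_cyclicSpan hb'A)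
    (fun _ => apply_mem_cyclicSpan hxA) ?_
  · intro y hy h0
    by_contra hy0
    obtain ⟨t, ht, ht0⟩ := hsv.exists_pairing_ne_zero hh hsN hadj hk hvv hy hy0
    exact ht0 (h0 t ht)
  · intro t ht ht0
    have hft := apply_eq_zero_of_mem_cyclicSpan hsN (aeval_mem_adjoin_pair f) hv ht
    obtain ⟨c, e, hce⟩ := isCoprime_of_norm_mk_ne_zero hf hm (hP.trans_ne hz)
    have := LinearMap.congr_fun (congrArg (aeval s) hce) t
    simpa [hft, ht0] using this.symm

theorem exists_isometry_of_isotropic_pair [Finite F] [FiniteDimensional F V]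
    (hh : ∀ x y, h x y = star (h y x)) (hsN : Commute s N)
    (hadj : ∀ φ ∈ Algebra.adjoin F {s, N}, ∃ φ' ∈ Algebra.adjoin F {s, N},
      ∀ x y, h (φ x) y = h x (φ' y))
    {x : End F V} (hxA : x ∈ Algebra.adjoin F {s, N}) (hx : ∀ v w, h (x v) (x w) = h v w)
    {f f' P : F[X]} (hf : Irreducible f) (hm : f.Monic) {z : F}
    (hP : Algebra.norm F (AdjoinRoot.mk f P) = z) (hz : z ≠ 0)
    (hff : ∀ x y, h (aeval s f x) y = h x (aeval s f' y)) (hco : IsCoprime f f')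
    {v w : V} (hv : aeval s f v = 0) (hw : aeval s f' w = 0) (hws : IsSimpleVector s w)
    {k : ℕ} (hk : (N ^ (k + 1)) v = 0) (hkw : (N ^ (k + 1)) w = 0)
    (hwv : h w ((N ^ k) v) ≠ 0) (hvw : h v ((N ^ k) w) ≠ 0) :
    ∃ g : End F V, (∀ v w, h (g v) (g w) = h v w) ∧ Commute g x ∧
      LinearMap.det g * star (z ^ (k + 1)) = z ^ (k + 1) := by
  obtain ⟨c₁, c₂, hc⟩ := hco
  have hsv := isSimpleVector_of_irreducible hf hv
  have hk' : (N ^ k) v ≠ 0 := fun h0 => hwv (by rw [h0, map_zero])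
  have hfv : ∀ t ∈ cyclicSpan s N v, aeval s f t = 0 := fun t ht =>
    apply_eq_zero_of_mem_cyclicSpan hsN (aeval_mem_adjoin_pair f) hv ht
  have hfw : ∀ t ∈ cyclicSpan s N w, aeval s f' t = 0 := fun t ht =>
    apply_eq_zero_of_mem_cyclicSpan hsN (aeval_mem_adjoin_pair f') hw ht
  have hvv0 : ∀ a ∈ cyclicSpan s N v, ∀ b ∈ cyclicSpan s N v, h a b = 0 := by
    intro a ha b hb
    have := LinearMap.congr_fun (congrArg (aeval s) hc) b
    rw [mul_comm c₂] at this
    simp only [map_add, map_mul, LinearMap.add_apply, Module.End.mul_apply, hfv b hb, map_zero,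
      zero_add, map_one, Module.End.one_apply] at this
    rw [← this, ← hff, hfv a ha, map_zero, LinearMap.zero_apply]
  have hww0 : ∀ a ∈ cyclicSpan s N w, ∀ b ∈ cyclicSpan s N w, h a b = 0 := by
    intro a ha b hb
    have := LinearMap.congr_fun (congrArg (aeval s) hc) a
    rw [mul_comm c₁] at this
    simp only [map_add, map_mul, LinearMap.add_apply, Module.End.mul_apply, hfw a ha, map_zero,
      add_zero, map_one, Module.End.one_apply] at this
    rw [← this, hff, hfw b hb, map_zero]
  have hpv : ∀ t ∈ cyclicSpan s N v, t ≠ 0 → ∃ x ∈ cyclicSpan s N w, h x t ≠ 0 :=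
    fun t ht ht0 => hsv.exists_pairing_ne_zero hh hsN hadj hk hwv ht ht0
  have hpw : ∀ t ∈ cyclicSpan s N w, t ≠ 0 → ∃ x ∈ cyclicSpan s N v, h x t ≠ 0 :=
    fun t ht ht0 => hws.exists_pairing_ne_zero hh hsN hadj hkw hvw ht ht0
  have hdisj : Disjoint (cyclicSpan s N v) (cyclicSpan s N w) := by
    rw [Submodule.disjoint_def]
    intro t ht ht'
    by_contra ht0
    obtain ⟨x, hx, hx0⟩ := hpv t ht ht0
    exact hx0 (hww0 x hx t ht')
  set Q : F[X] := 1 + (P - 1) * (c₂ * f') with hQ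
  have hQP : AdjoinRoot.mk f Q = AdjoinRoot.mk f P := by
    rw [AdjoinRoot.mk_eq_mk]
    refine ⟨(1 - P) * c₁, ?_⟩
    rw [hQ]
    linear_combination (P - 1) * hc
  have hQw : ∀ t ∈ cyclicSpan s N w, aeval s Q t = t := by
    intro t ht
    simp [hQ, hfw t ht]
  have hQA := aeval_mem_adjoin_pair (s := s) (N := N) Q
  obtain ⟨b', hb'A, hb'⟩ := hadj _ hQA
  have hinv : ∀ φ ∈ Algebra.adjoin F {s, N}, ∀ t ∈ cyclicSpan s N v ⊔ cyclicSpan s N w,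
      φ t ∈ cyclicSpan s N v ⊔ cyclicSpan s N w := by
    intro φ hφ t ht
    obtain ⟨a, ha, b, hb, rfl⟩ := Submodule.mem_sup.1 ht
    rw [map_add]
    exact Submodule.add_mem_sup (apply_mem_cyclicSpan hφ ha) (apply_mem_cyclicSpan hφ hb)
  have hdet : detOn (aeval s Q) (cyclicSpan s N v ⊔ cyclicSpan s N w) = z ^ (k + 1) := by
    rw [detOn_sup hdisj (fun _ => apply_mem_cyclicSpan hQA) (fun _ => apply_mem_cyclicSpan hQA),
      detOn_eq_one hQw, mul_one, detOn_aeval_cyclicSpan hf hm hsN hv hk hk', hQP, hP]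
  rw [← hdet]
  refine exists_isometry_of_normal hh ?_ hb' (commute_of_mem_adjoin_pair hsN hQA hb'A) hx
    (commute_of_mem_adjoin_pair hsN hQA hxA) (commute_of_mem_adjoin_pair hsN hb'A hxA)
    (hinv _ hQA) (hinv _ hb'A) (hinv _ hxA) ?_
  · intro y hy h0
    obtain ⟨a, ha, b, hb, rfl⟩ := Submodule.mem_sup.1 hy
    have ha0 : a = 0 := by
      by_contra ha0
      obtain ⟨t, ht, ht0⟩ := hpv a ha ha0
      apply ht0
      have := h0 t (Submodule.mem_sup_right ht)
      rwa [map_add, hww0 t ht b hb, add_zero] at this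
    have hb0 : b = 0 := by
      by_contra hb0
      obtain ⟨t, ht, ht0⟩ := hpw b hb hb0
      apply ht0
      have := h0 t (Submodule.mem_sup_left ht)
      rwa [map_add, hvv0 t ht a ha, zero_add] at this
    rw [ha0, hb0, add_zero]
  · intro t ht ht0
    obtain ⟨a, ha, b, hb, rfl⟩ := Submodule.mem_sup.1 ht
    rw [map_add, hQw b hb] at ht0
    have hb0 : b = 0 := by
      refine Submodule.disjoint_def.1 hdisj b ?_ hb
      rw [eq_neg_of_add_eq_zero_right ht0]
      exact neg_mem (apply_mem_cyclicSpan hQA ha)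
    rw [hb0, add_zero] at ht0 ⊢
    obtain ⟨c, e, hce⟩ := isCoprime_of_norm_mk_ne_zero (P := Q) hf hm (by rwa [hQP, hP])
    have := LinearMap.congr_fun (congrArg (aeval s) hce) a
    simpa [hfv a ha, ht0] using this.symm

theorem exists_apply_self_ne_zero {B : V → V → F}
    (hadd : ∀ x y z, B (x + y) z = B x z + B y z) (hadd' : ∀ x y z, B x (y + z) = B x y + B x z)
    (hsmul : ∀ (c : F) x y, B (c • x) y = star c * B x y)
    (hsmul' : ∀ (c : F) x y, B x (c • y) = c * B x y) (hstar : ∃ c : F, star c ≠ c)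
    {W : Submodule F V} {v w : V} (hv : v ∈ W) (hw : w ∈ W) (hwv : B w v ≠ 0) :
    ∃ t ∈ W, B t t ≠ 0 := by
  by_contra! hcon
  obtain ⟨c, hc⟩ := hstar
  have h1 := hcon _ hv
  have h2 := hcon _ hw
  have h3 := hcon _ (add_mem hv hw)
  have h4 := hcon _ (add_mem hv (W.smul_mem c hw))
  simp only [hadd, hadd', hsmul, hsmul', h1, h2] at h3 h4
  have : (star c - c) * B w v = 0 := by linear_combination h4 - c * h3
  rcases mul_eq_zero.1 this with h5 | h5
  exacts [hc (sub_eq_zero.1 h5), hwv h5]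

theorem pow_sub_one_pow_eq {R : Type*} [Ring R] {u : R} {m : ℕ} (hm : u ^ (m + 1) = 1) (j : ℕ) :
    (u ^ m - 1) ^ j = (-1) ^ j * (u ^ m) ^ j * (u - 1) ^ j := by
  have h1 : u ^ m - 1 = -(u ^ m * (u - 1)) := by
    rw [mul_sub, mul_one, ← pow_succ, hm, neg_sub]
  have h2 : Commute (u ^ m) (u - 1) :=
    ((Commute.refl u).sub_right (Commute.one_right u)).pow_left m
  rw [h1, neg_pow, h2.mul_pow, mul_assoc]

theorem pow_sub_one_pow_apply_eq_zero_iff {F V : Type*} [Field F] [AddCommGroup V] [Module F V]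
    {u : End F V} {m : ℕ} (hm : u ^ (m + 1) = 1) {j : ℕ} {t : V} :
    ((u ^ m - 1) ^ j) t = 0 ↔ ((u - 1) ^ j) t = 0 := by
  have hu : u ^ j * (u ^ m) ^ j = 1 := by
    rw [← pow_mul, ← pow_add, show j + m * j = (m + 1) * j by ring, pow_mul, hm, one_pow]
  have hinj : ∀ t, ((u ^ m) ^ j) t = 0 ↔ t = 0 := by
    refine fun t => ⟨fun ht => ?_, fun ht => by rw [ht, map_zero]⟩
    have := LinearMap.congr_fun hu t
    rw [Module.End.mul_apply, ht, map_zero] at this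
    exact this.symm
  rw [pow_sub_one_pow_eq hm, mul_assoc, Module.End.mul_apply]
  rcases neg_one_pow_eq_or (End F V) j with h | h <;> rw [h] <;> simp [hinj]

/-- A Jordan block of size `k + 1` over an irreducible factor of the minimal polynomial of `s`
yields isometries centralizing `s * u` whose determinants are the `z ^ (k + 1) / star z ^ (k + 1)`. -/
theorem exists_isometry_of_jordanBlock [Finite F] [FiniteDimensional F V]
    (hh : ∀ x y, h x y = star (h y x)) (hnd : ∀ y, (∀ x, h x y = 0) → y = 0)
    {u : End F V} (hsu : Commute s u) (hs : ∀ x y, h (s x) (s y) = h x y)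
    (hu : ∀ x y, h (u x) (u y) = h x y) {r m : ℕ} (hr : s ^ (r + 1) = 1) (hm : u ^ (m + 1) = 1)
    {f g : F[X]} (hf : Irreducible f) (hfm : f.Monic) (hfg : X ^ (r + 1) - 1 = f * g)
    (hco : IsCoprime f g) {v : V} (hv : aeval s f v = 0) {k : ℕ}
    (hk : ((u - 1) ^ (k + 1)) v = 0)
    (hk' : ((u - 1) ^ k) v ∉ LinearMap.range ((u - 1) ^ (k + 1))) (hstar : ∃ c : F, star c ≠ c)
    {z : F} (hz : z ≠ 0) :
    ∃ x : End F V, (∀ v w, h (x v) (x w) = h v w) ∧ Commute x (s * u) ∧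
      LinearMap.det x * star (z ^ (k + 1)) = z ^ (k + 1) := by
  set N := u - 1 with hN
  have hu1 : u = N + 1 := by rw [hN, sub_add_cancel]
  have hsN : Commute s N := hsu.sub_right (Commute.one_right s)
  have hsA : s ∈ Algebra.adjoin F {s, N} := left_mem_adjoin_pair
  have hNA : N ∈ Algebra.adjoin F {s, N} := right_mem_adjoin_pair
  have huA : u ∈ Algebra.adjoin F {s, N} := hu1 ▸ add_mem hNA (one_mem _)
  have hs' : ∀ x y, h (s x) y = h x (aeval s (X ^ r : F[X]) y) := by
    intro x y
    rw [← hs x, aeval_X_pow, ← Module.End.mul_apply, ← pow_succ', hr, Module.End.one_apply]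
  have hu' : ∀ x y, h (u x) y = h x ((u ^ m) y) := by
    intro x y
    rw [← hu x, ← Module.End.mul_apply, ← pow_succ', hm, Module.End.one_apply]
  set N' := u ^ m - 1 with hN'
  have hNN' : ∀ x y, h (N x) y = h x (N' y) := by
    intro x y
    simp [hN, hN', hu']
  have hadj : ∀ φ ∈ Algebra.adjoin F {s, N}, ∃ φ' ∈ Algebra.adjoin F {s, N},
      ∀ x y, h (φ x) y = h x (φ' y) := by
    intro φ hφ
    refine exists_adjoint_of_mem_adjoin ?_ hφ
    rintro _ (rfl | rfl)
    · exact ⟨_, aeval_mem_adjoin_pair _, hs'⟩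
    · exact ⟨N', sub_mem (pow_mem huA m) (one_mem _), hNN'⟩
  have hpoly := exists_adjoint_aeval hs'
  have hN'k : ∀ j, N' ^ j = (-1) ^ j * (u ^ m) ^ j * N ^ j := pow_sub_one_pow_eq hm
  have hkerN : ∀ j t, (N' ^ j) t = 0 → (N ^ j) t = 0 := fun j t =>
    (pow_sub_one_pow_apply_eq_zero_iff hm).1
  obtain ⟨ℓ, hℓ, hℓr⟩ := Submodule.exists_le_ker_of_notMem hk'
  obtain ⟨w₀, rfl⟩ := exists_apply_eq_of_nondegenerate hh hnd ℓ
  have hw₀ : (N ^ (k + 1)) w₀ = 0 := by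
    apply hkerN
    refine hnd _ fun y => ?_
    rw [← adjoint_pow hNN', hh]
    exact (star_eq_zero).2 (hℓr ⟨y, rfl⟩)
  obtain ⟨c₁, c₂, hc⟩ := hco
  obtain ⟨e', he'⟩ := hpoly (c₂ * g)
  obtain ⟨f', hf'⟩ := hpoly f
  have hev : aeval s (c₂ * g) v = v := by
    have := LinearMap.congr_fun (congrArg (aeval s) hc) v
    simpa [hv] using this
  have hfe : aeval s f * aeval s (c₂ * g) = 0 := by
    rw [← map_mul, mul_left_comm, ← hfg, map_mul, map_sub, aeval_X_pow, hr, map_one, sub_self,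
      mul_zero]
  set w := aeval s e' w₀ with hw
  have hcomm : ∀ a j y, aeval s a ((N ^ j) y) = (N ^ j) (aeval s a y) := fun a j =>
    LinearMap.congr_fun
      (commute_of_mem_adjoin_pair hsN (aeval_mem_adjoin_pair a) (pow_mem hNA j)).eq
  have hwv : h w ((N ^ k) v) ≠ 0 := by
    rw [hw, adjoint_symm hh he', hcomm, hev]
    exact hℓ
  have hwk : (N ^ (k + 1)) w = 0 := by rw [hw, ← hcomm, hw₀, map_zero]
  have hwf' : aeval s f' w = 0 := by
    have h0 : ∀ y, h (aeval s f' w) y = 0 := by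
      intro y
      rw [adjoint_symm hh hf', hw, adjoint_symm hh he', ← Module.End.mul_apply, ← map_mul,
        mul_comm _ f, map_mul, hfe, LinearMap.zero_apply, map_zero]
    exact hnd _ fun y => by rw [hh, h0, star_zero]
  have hxA : s * u ∈ Algebra.adjoin F {s, N} := mul_mem hsA huA
  have hx : ∀ v w, h ((s * u) v) ((s * u) w) = h v w := fun v w => by
    simp only [Module.End.mul_apply, hs, hu]
  obtain ⟨P, hP⟩ := exists_norm_mk_eq hf hfm z
  have hkill : ∀ a a' : F[X], (∀ x y, h (aeval s a x) y = h x (aeval s a' y)) → f ∣ a' →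
      aeval s a w = 0 := by
    rintro a _ ha ⟨b, rfl⟩
    obtain ⟨b', hb'⟩ := hpoly b
    refine hnd _ fun y => ?_
    rw [hh, ha, map_mul, Module.End.mul_apply, ← adjoint_symm hh hf', hwf', map_zero,
      LinearMap.zero_apply, star_zero]
  rcases hf.isCoprime_or_dvd f' with hff | hff
  · have hws : IsSimpleVector s w := by
      intro a
      obtain ⟨a', ha'⟩ := hpoly a
      rcases hf.isCoprime_or_dvd a' with ⟨d₁, d₂, hd⟩ | hd
      · right
        obtain ⟨d', hd'⟩ := hpoly d₂
        obtain ⟨d₁', hd₁'⟩ := hpoly d₁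
        refine ⟨d', ?_⟩
        rw [← sub_eq_zero]
        refine hnd _ fun y => ?_
        rw [hh, map_sub, LinearMap.sub_apply, adjoint_symm hh hd', ha', star_eq_zero]
        have h5 := LinearMap.congr_fun (congrArg (aeval s) hd) y
        simp only [map_add, map_mul, LinearMap.add_apply, Module.End.mul_apply, map_one,
          Module.End.one_apply] at h5
        have h6 : h w (aeval s d₁ (aeval s f y)) = 0 := by
          rw [← Module.End.mul_apply, ← map_mul, mul_comm, map_mul, Module.End.mul_apply,
            ← adjoint_symm hh hf', hwf', map_zero, LinearMap.zero_apply]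
        have h7 : aeval s d₂ (aeval s a' y) = aeval s a' (aeval s d₂ y) := by
          rw [← Module.End.mul_apply, ← map_mul, mul_comm, map_mul, Module.End.mul_apply]
        rw [← h7, sub_eq_zero]
        conv_rhs => rw [← h5]
        rw [map_add, h6, zero_add]
      · exact Or.inl (hkill a a' ha' hd)
    have hvw : h v ((N ^ k) w) ≠ 0 := by
      intro h0
      apply hwv
      have h8 : (N' ^ k) v = ((-1) ^ k * N ^ k : End F V) v := by
        have h9 : ∀ j, (u ^ j) ((N ^ k) v) = (N ^ k) v := by
          intro j
          induction j with
          | zero => rfl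
          | succ j ih =>
            rw [pow_succ, Module.End.mul_apply]
            conv_lhs => rw [hu1]
            rw [LinearMap.add_apply, ← Module.End.mul_apply, ← pow_succ', hk, zero_add, ← hu1]
            exact ih
        rw [hN'k, mul_assoc, Module.End.mul_apply, Module.End.mul_apply, ← pow_mul, h9,
          Module.End.mul_apply]
      rw [hh, adjoint_pow hNN', h8, star_eq_zero] at h0
      rcases neg_one_pow_eq_or (End F V) k with h4 | h4 <;> rw [h4] at h0 <;> simpa using h0
    exact exists_isometry_of_isotropic_pair hh hsN hadj hxA hx hf hfm hP hz hf' hff hv hwf' hws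
      hk hwk hwv hvw
  · have hwf : aeval s f w = 0 := hkill f f' hf' hff
    obtain ⟨t, ⟨ht, ht'⟩, htt⟩ := exists_apply_self_ne_zero (B := fun x y => h x ((N ^ k) y))
      (W := LinearMap.ker (aeval s f) ⊓ LinearMap.ker (N ^ (k + 1)))
      (by simp) (by simp) (by simp [starRingEnd_apply]) (by simp) hstar ⟨hv, hk⟩ ⟨hwf, hwk⟩ hwv
    exact exists_isometry_of_cyclicSpan hh hsN hadj hxA hx hf hfm hP hz ht ht' htt

theorem exists_det_eq_pow [FiniteDimensional F V] (hnd : ∀ y, (∀ x, h x y = 0) → y = 0)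
    {N' g : End F V} (hN : ∀ x y, h (N x) y = h x (N' y))
    (hker : ∀ j t, (N' ^ j) t = 0 ↔ (N ^ j) t = 0) (hnil : IsNilpotent N)
    (hg : ∀ x y, h (g x) (g y) = h x y) (hgN : Commute g N) {d : ℕ} (hd0 : 0 < d)
    (hd : ∀ j, ¬ d ∣ j + 1 → ∀ v, (N ^ (j + 1)) v = 0 →
      (N ^ j) v ∈ LinearMap.range (N ^ (j + 1))) :
    ∃ δ : F, star δ * δ = 1 ∧ LinearMap.det g = δ ^ d := by
  set D : ℕ → F := fun j => detOn g (LinearMap.range (N ^ j)) with hD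
  set κ : ℕ → F := fun j => detOn g (LinearMap.range (N ^ j) ⊓ LinearMap.ker N) with hκ
  have hinv : ∀ j, ∀ t ∈ LinearMap.range (N ^ j), g t ∈ LinearMap.range (N ^ j) := by
    rintro j _ ⟨t, rfl⟩
    exact ⟨g t, LinearMap.congr_fun (hgN.pow_right j).eq.symm t⟩
  have hDκ : ∀ j, D j = κ j * D (j + 1) := by
    intro j
    simp only [hD, hκ]
    rw [detOn_eq_mul hgN (hinv j), pow_succ', Module.End.mul_eq_comp, LinearMap.range_comp]
  have hDstar : ∀ j, star (D j) * D j = 1 := fun j =>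
    star_detOn_range_mul_self hnd (adjoint_pow hN j) (hker j) hg (hgN.pow_right j)
  have hκstar : ∀ j, star (κ j) * κ j = 1 := by
    intro j
    have h1 := hDstar j
    have h2 := hDstar (j + 1)
    rw [hDκ, star_mul] at h1
    linear_combination h1 - star (κ j) * κ j * h2
  have hκκ : ∀ j, ¬ d ∣ j + 1 → κ j = κ (j + 1) := by
    intro j hj
    simp only [hκ]
    congr 1
    refine le_antisymm ?_ (inf_le_inf_right _ ?_)
    · rintro _ ⟨⟨v, rfl⟩, hv⟩
      refine ⟨hd j hj v ?_, hv⟩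
      rw [pow_succ']
      exact hv
    · rintro _ ⟨v, rfl⟩
      exact ⟨N v, by rw [pow_succ]; rfl⟩
  have hblock : ∀ a i, i < d → κ (d * a + i) = κ (d * a) := by
    intro a i
    induction i with
    | zero => exact fun _ => rfl
    | succ i ih =>
      intro hi
      have hni : ¬ d ∣ d * a + i + 1 := by
        rw [add_assoc, ← Nat.dvd_add_iff_right (dvd_mul_right d a)]
        exact Nat.not_dvd_of_pos_of_lt (by omega) hi
      rw [← ih (by omega), ← add_assoc, hκκ _ hni]
  have hDblock : ∀ a i, i ≤ d → D (d * a) = κ (d * a) ^ i * D (d * a + i) := by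
    intro a i
    induction i with
    | zero => simp
    | succ i ih =>
      intro hi
      rw [ih (by omega), hDκ, hblock a i hi, pow_succ, ← add_assoc, mul_assoc]
  have hmain : ∀ a, ∃ δ : F, star δ * δ = 1 ∧ D 0 = δ ^ d * D (d * a) := by
    intro a
    induction a with
    | zero => exact ⟨1, by simp, by simp⟩
    | succ a ih =>
      obtain ⟨δ, h1, h2⟩ := ih
      refine ⟨δ * κ (d * a), ?_, ?_⟩
      · rw [star_mul]
        linear_combination star (κ (d * a)) * κ (d * a) * h1 + hκstar (d * a)
      · rw [h2, hDblock a d le_rfl, mul_pow, mul_assoc, mul_add_one]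
  obtain ⟨e, he⟩ := hnil
  obtain ⟨δ, h1, h2⟩ := hmain e
  refine ⟨δ, h1, ?_⟩
  have h3 : D 0 = LinearMap.det g := by
    simp only [hD, pow_zero, Module.End.one_eq_id, LinearMap.range_id, detOn_top]
  have h4 : D (d * e) = 1 := by
    simp only [hD, mul_comm d e, pow_mul, he, zero_pow hd0.ne', LinearMap.range_zero, detOn_bot]
  rw [← h3, h2, h4, mul_one]

end Isometry

section Jordan

variable {K V W : Type*} [Field K] [AddCommGroup V] [Module K V] [AddCommGroup W] [Module K W]

theorem exists_pseudoinverse (T : V →ₗ[K] W) : ∃ G : W →ₗ[K] V, ∀ x, T (G (T x)) = T x := by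
  obtain ⟨R, hR⟩ := LinearMap.exists_rightInverse_of_surjective T.rangeRestrict
    (LinearMap.range_eq_top.2 T.surjective_rangeRestrict)
  obtain ⟨G, hG⟩ := LinearMap.exists_extend R
  refine ⟨G, fun x => ?_⟩
  have h1 : G (T x) = R (T.rangeRestrict x) := LinearMap.congr_fun hG (T.rangeRestrict x)
  rw [h1]
  exact congrArg Subtype.val (LinearMap.congr_fun hR (T.rangeRestrict x))

/-- The parts of the Jordan type of `1 + N` on `E`, detected by vectors. -/
theorem mem_jordanType_iff [FiniteDimensional K V] {N : End K V} {E : Submodule K V}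
    (hE : ∀ x ∈ E, N x ∈ E) {Λ : Multiset ℕ}
    (hΛ : ∀ k : ℕ, 1 ≤ k → (Λ.filter (fun i => k ≤ i)).card =
      finrank K (E.map (N ^ (k - 1))) - finrank K (E.map (N ^ k))) (k : ℕ) :
    k + 1 ∈ Λ ↔ ∃ v ∈ E, (N ^ (k + 1)) v = 0 ∧ (N ^ k) v ∉ E.map (N ^ (k + 1)) := by
  set A : ℕ → Submodule K V := fun j => E.map (N ^ j) ⊓ LinearMap.ker N with hA
  have hmap : ∀ j, (E.map (N ^ j)).map N = E.map (N ^ (j + 1)) := by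
    intro j
    rw [← Submodule.map_comp, pow_succ', Module.End.mul_eq_comp]
  have hrank : ∀ j, (Λ.filter (fun i => j + 1 ≤ i)).card = finrank K (A j) := by
    intro j
    have h1 := LinearMap.finrank_range_add_finrank_ker (N.domRestrict (E.map (N ^ j)))
    rw [LinearMap.range_domRestrict, hmap, LinearMap.ker_domRestrict] at h1
    rw [← Submodule.finrank_map_subtype_eq, Submodule.map_comap_subtype] at h1
    change _ + finrank K (A j) = _ at h1
    rw [hΛ (j + 1) (by omega), Nat.add_sub_cancel]
    omega
  have hle : A (k + 1) ≤ A k := by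
    refine inf_le_inf_right _ ?_
    rintro _ ⟨v, hv, rfl⟩
    exact ⟨N v, hE v hv, by rw [pow_succ]; rfl⟩
  have hcount : finrank K (A k) = Λ.count (k + 1) + finrank K (A (k + 1)) := by
    rw [← hrank, ← hrank]
    have h1 : Λ.filter (fun i => k + 1 ≤ i) =
        Λ.filter (fun i => i = k + 1) + Λ.filter (fun i => k + 1 + 1 ≤ i) := by
      rw [Multiset.filter_add_filter, (Multiset.filter_eq_nil (p := fun i => _ ∧ _)).2, add_zero]
      · exact Multiset.filter_congr fun i _ => by omega
      · intro i _; omega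
    rw [h1, Multiset.card_add, Multiset.count_eq_card_filter_eq]
    simp only [eq_comm]
  rw [← Multiset.one_le_count_iff_mem]
  constructor
  · intro h
    by_contra! hcon
    have : A k ≤ A (k + 1) := by
      rintro _ ⟨⟨v, hv, rfl⟩, hv0⟩
      exact ⟨hcon v hv (by rw [pow_succ']; exact hv0), hv0⟩
    rw [le_antisymm this hle] at hcount
    omega
  · rintro ⟨v, hv, h0, hn⟩
    have hlt : A (k + 1) < A k := by
      refine lt_of_le_of_ne hle fun heq => hn ?_
      have : (N ^ k) v ∈ A k := ⟨⟨v, hv, rfl⟩, by rw [pow_succ'] at h0; exact h0⟩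
      rw [← heq] at this
      exact this.1
    have := Submodule.finrank_lt_finrank_of_lt hlt
    omega

variable {s N : End K V}

open Polynomial in
/-- The projection onto an eigenspace of an operator of finite order prime to the
characteristic. -/
theorem exists_aeval_projection {r : ℕ} (hr0 : (r : K) ≠ 0) (hr : s ^ r = 1) {ξ : K}
    (hξ : s.HasEigenvalue ξ) : ∃ π : K[X], (∀ x, s (aeval s π x) = ξ • aeval s π x) ∧
      ∀ x ∈ s.eigenspace ξ, aeval s π x = x := by
  have heig : ∀ a : K[X], ∀ x ∈ s.eigenspace ξ, aeval s a x = a.eval ξ • x := by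
    intro a x hx
    rcases eq_or_ne x 0 with rfl | hx0
    · simp
    · exact Module.End.aeval_apply_of_hasEigenvector ⟨hx, hx0⟩
  have hroot : (X ^ r - 1 : K[X]).eval ξ = 0 := by
    obtain ⟨x, hx, hx0⟩ := hξ.exists_hasEigenvector
    have := heig (X ^ r - 1) x hx
    rw [map_sub, aeval_X_pow, hr, map_one, sub_self, LinearMap.zero_apply] at this
    exact (smul_eq_zero.1 this.symm).resolve_right hx0
  obtain ⟨g, hg⟩ := dvd_iff_isRoot.2 hroot
  have hgξ : g.eval ξ ≠ 0 := by
    intro h0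
    have h1 := congrArg (fun a => (derivative a).eval ξ) hg
    simp only [derivative_sub, derivative_X_pow, derivative_one, derivative_mul, derivative_X,
      derivative_C, eval_sub, eval_mul, eval_add, eval_X, eval_C, eval_pow, eval_zero, eval_one, h0]
      at h1
    have h2 : ξ ^ (r - 1) ≠ 0 := by
      refine pow_ne_zero _ fun h3 => ?_
      subst h3
      have hr' : r ≠ 0 := fun h4 => hr0 (by simp [h4])
      simp [hr'] at hroot
    exact mul_ne_zero hr0 h2 (by simpa using h1)
  refine ⟨C (g.eval ξ)⁻¹ * g, fun x => ?_, fun x hx => ?_⟩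
  · have h1 := LinearMap.congr_fun (congrArg (aeval s) hg) x
    rw [map_sub, aeval_X_pow, hr, map_one, sub_self] at h1
    simp only [map_mul, map_sub, aeval_X, aeval_C, Module.End.mul_apply, LinearMap.sub_apply,
      LinearMap.zero_apply, Module.algebraMap_end_apply] at h1 ⊢
    rw [map_smul, sub_eq_zero.1 h1.symm, smul_comm]
  · rw [heig _ x hx, eval_mul, eval_C, inv_mul_cancel₀ hgξ, one_smul]

theorem ker_pow_le_of_forall_eigenspace [IsAlgClosed K] [FiniteDimensional K V] {r : ℕ} (hr0 : (r : K) ≠ 0)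
    (hr : s ^ r = 1) (hsN : Commute s N) {k : ℕ} {T : Submodule K V}
    (h : ∀ ξ, s.HasEigenvalue ξ → ∀ v ∈ s.eigenspace ξ, (N ^ k) v = 0 → v ∈ T) {v : V}
    (hv : (N ^ k) v = 0) : v ∈ T := by
  have hss : s.IsSemisimple := by
    refine Module.End.isSemisimple_of_squarefree_aeval_eq_zero
      (p := Polynomial.X ^ r - 1) (Polynomial.X_pow_sub_one_separable_iff.2 hr0).squarefree ?_
    rw [map_sub, Polynomial.aeval_X_pow, hr, map_one, sub_self]
  have htop : ⨆ ξ : K, s.genEigenspace ξ ⊤ = ⊤ := Module.End.iSup_maxGenEigenspace_eq_top s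
  have h1 := Submodule.inf_iSup_genEigenspace (f := s) (p := LinearMap.ker (N ^ k)) ?_ ⊤
  · rw [htop, inf_top_eq] at h1
    have h2 : v ∈ LinearMap.ker (N ^ k) := hv
    rw [h1] at h2
    refine (iSup_le fun ξ => ?_ : _ ≤ T) h2
    rintro x ⟨hx, hx'⟩
    have hx' : x ∈ s.maxGenEigenspace ξ := hx'
    rw [hss.isFinitelySemisimple.maxGenEigenspace_eq_eigenspace] at hx'
    rcases eq_or_ne x 0 with rfl | hx0
    · exact zero_mem _
    · exact h ξ (Module.End.hasEigenvalue_of_hasEigenvector ⟨hx', hx0⟩) x hx' hx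
  · intro x hx
    have := LinearMap.congr_fun (hsN.pow_right k).eq x
    simp only [Module.End.mul_apply, LinearMap.mem_ker] at this hx ⊢
    rw [← this, hx, map_zero]

end Jordan

section ExtendScalars

open Polynomial

variable {F K : Type*} [Field F] [Field K] [Algebra F K] {ι : Type*} [Fintype ι] [DecidableEq ι]

/-- Extension of scalars for endomorphisms of a coordinate space. -/
noncomputable def extendScalars (F K ι : Type*) [Field F] [Field K] [Algebra F K] [Fintype ι]
    [DecidableEq ι] : End F (ι → F) →ₐ[F] End K (ι → K) :=
  (((Matrix.toLinAlgEquiv' (R := K) (n := ι)).toAlgHom.restrictScalars F).comp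
    (Algebra.ofId F K).mapMatrix).comp (LinearMap.toMatrixAlgEquiv' (R := F) (n := ι)).toAlgHom

theorem extendScalars_toLin' (M : Matrix ι ι F) :
    extendScalars F K ι (Matrix.toLin' M) = Matrix.toLin' (M.map (algebraMap F K)) := by
  have : LinearMap.toMatrixAlgEquiv' (Matrix.toLin' M) = M :=
    LinearMap.toMatrixAlgEquiv'.apply_symm_apply M
  change Matrix.toLin' ((LinearMap.toMatrixAlgEquiv' (Matrix.toLin' M)).map (algebraMap F K)) = _
  rw [this]

theorem extendScalars_apply (φ : End F (ι → F)) (v : ι → F) :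
    extendScalars F K ι φ (algebraMap F K ∘ v) = algebraMap F K ∘ φ v := by
  obtain ⟨M, rfl⟩ := Matrix.toLin'.surjective φ
  rw [extendScalars_toLin', Matrix.toLin'_apply, Matrix.toLin'_apply]
  ext i
  exact (RingHom.map_mulVec _ M v i).symm

variable {s N : End F (ι → F)}

theorem pow_apply_mem_range_of_eigenspace [IsAlgClosed K] {r : ℕ} (hr0 : (r : F) ≠ 0) (hr : s ^ r = 1)
    (hsN : Commute s N) {k : ℕ}
    (h : ∀ ξ : K, (extendScalars F K ι s).HasEigenvalue ξ →
      ∀ v ∈ (extendScalars F K ι s).eigenspace ξ, (extendScalars F K ι N ^ (k + 1)) v = 0 →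
        (extendScalars F K ι N ^ k) v ∈ LinearMap.range (extendScalars F K ι N ^ (k + 1)))
    {v : ι → F} (hv : (N ^ (k + 1)) v = 0) :
    (N ^ k) v ∈ LinearMap.range (N ^ (k + 1)) := by
  set ρ := extendScalars F K ι
  have h1 := ker_pow_le_of_forall_eigenspace (s := ρ s) (N := ρ N) (r := r) (k := k + 1)
    (T := (LinearMap.range (ρ N ^ (k + 1))).comap (ρ N ^ k)) (v := algebraMap F K ∘ v)
    (by simpa using (map_ne_zero (algebraMap F K)).2 hr0) (by rw [← map_pow, hr, map_one])
    (hsN.map ρ) h (by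
      rw [← map_pow, extendScalars_apply, hv]
      ext; simp)
  obtain ⟨y, hy⟩ := h1
  obtain ⟨G, hG⟩ := exists_pseudoinverse (N ^ (k + 1))
  refine ⟨G ((N ^ k) v), ?_⟩
  have hG' : ∀ x, (ρ N ^ (k + 1)) (ρ G ((ρ N ^ (k + 1)) x)) = (ρ N ^ (k + 1)) x := by
    intro x
    have : N ^ (k + 1) * (G * N ^ (k + 1)) = N ^ (k + 1) := LinearMap.ext hG
    have := LinearMap.congr_fun (congrArg ρ this) x
    simpa using this
  have h2 := hG' y
  rw [hy, ← map_pow, ← map_pow, extendScalars_apply, extendScalars_apply, extendScalars_apply]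
    at h2
  exact (algebraMap F K).injective.comp_left h2

theorem exists_pow_apply_notMem_range {r : ℕ} (hr0 : (r : F) ≠ 0) (hr : s ^ r = 1)
    (hsN : Commute s N) {k : ℕ} {ξ : K} (hξ : (extendScalars F K ι s).HasEigenvalue ξ)
    {v : ι → K} (hv : v ∈ (extendScalars F K ι s).eigenspace ξ)
    (hk : (extendScalars F K ι N ^ (k + 1)) v = 0)
    (hk' : (extendScalars F K ι N ^ k) v ∉
      ((extendScalars F K ι s).eigenspace ξ).map (extendScalars F K ι N ^ (k + 1))) :
    ∃ f g : F[X], Irreducible f ∧ f.Monic ∧ X ^ r - 1 = f * g ∧ IsCoprime f g ∧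
      ∃ w, aeval s f w = 0 ∧ (N ^ (k + 1)) w = 0 ∧
        (N ^ k) w ∉ LinearMap.range (N ^ (k + 1)) := by
  set ρ := extendScalars F K ι
  have hv0 : v ≠ 0 := fun h0 => hk' (by rw [h0, map_zero]; exact zero_mem _)
  have heig : ∀ a : F[X], aeval (ρ s) a v = aeval ξ a • v := by
    intro a
    have h1 := Module.End.aeval_apply_of_hasEigenvector (f := ρ s) (p := a.map (algebraMap F K))
      ⟨hv, hv0⟩
    rwa [aeval_map_algebraMap, eval_map_algebraMap] at h1
  have hroot : aeval ξ (X ^ r - 1 : F[X]) = 0 := by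
    have h1 := heig (X ^ r - 1)
    rw [aeval_algHom_apply, map_sub, aeval_X_pow, hr, map_one, sub_self, map_zero,
      LinearMap.zero_apply] at h1
    exact (smul_eq_zero.1 h1.symm).resolve_right hv0
  have hr' : r ≠ 0 := fun h0 => hr0 (by simp [h0])
  have hint : IsIntegral F ξ := ⟨X ^ r - 1, monic_X_pow_sub_C 1 hr', hroot⟩
  obtain ⟨g, hg⟩ := minpoly.dvd F ξ hroot
  have hsep := X_pow_sub_one_separable_iff.2 hr0
  rw [hg] at hsep
  refine ⟨minpoly F ξ, g, minpoly.irreducible hint, minpoly.monic hint, hg, hsep.isCoprime, ?_⟩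
  by_contra! hcon
  obtain ⟨G, hG⟩ := exists_pseudoinverse (N ^ (k + 1))
  set M : End F (ι → F) := (1 - N ^ (k + 1) * G) * N ^ k with hM
  set T := (N ^ (k + 1)).prod (aeval s (minpoly F ξ)) with hT
  obtain ⟨H, hH⟩ := exists_pseudoinverse T
  have hMker : ∀ x, T x = 0 → M x = 0 := by
    intro x hx
    obtain ⟨h1, h2⟩ := Prod.ext_iff.1 hx
    obtain ⟨y, hy⟩ := hcon x h2 h1
    simp only [hM, Module.End.mul_apply, LinearMap.sub_apply, Module.End.one_apply]
    rw [← hy, hG, sub_self]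
  have hMT : M = M * (H ∘ₗ LinearMap.inl F _ _) * N ^ (k + 1) +
      M * (H ∘ₗ LinearMap.inr F _ _) * aeval s (minpoly F ξ) := by
    refine LinearMap.ext fun x => ?_
    have h1 := hMker (x - H (T x)) (by rw [map_sub, hH, sub_self])
    rw [map_sub, sub_eq_zero] at h1
    have h2 : T x = LinearMap.inl F (ι → F) (ι → F) ((N ^ (k + 1)) x) +
        LinearMap.inr F (ι → F) (ι → F) (aeval s (minpoly F ξ) x) := by
      simp [hT]
    rw [h1, h2, map_add, map_add]
    rfl
  have h1 : ρ M v = 0 := by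
    rw [hMT]
    simp only [map_add, map_mul, map_pow, LinearMap.add_apply, Module.End.mul_apply, hk,
      map_zero, zero_add, ← aeval_algHom_apply, heig, minpoly.aeval, zero_smul]
  obtain ⟨π, hπ, hπ'⟩ := exists_aeval_projection (s := ρ s) (r := r) (ξ := ξ)
    (by simpa using (map_ne_zero (algebraMap F K)).2 hr0) (by rw [← map_pow, hr, map_one]) hξ
  have hcs : ∀ j, Commute (aeval (ρ s) π) (ρ N ^ j) := fun j =>
    (Algebra.commute_of_mem_adjoin_of_forall_mem_commute
      (aeval_mem_adjoin_singleton K (ρ s)) (by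
        rintro _ rfl
        exact ((hsN.map ρ).pow_right j).symm)).symm
  apply hk'
  refine ⟨aeval (ρ s) π (ρ G ((ρ N ^ k) v)), ?_, ?_⟩
  · exact Module.End.mem_eigenspace_iff.2 (hπ _)
  · have h2 := LinearMap.congr_fun (hcs (k + 1)).eq (ρ G ((ρ N ^ k) v))
    have h3 := LinearMap.congr_fun (hcs k).eq v
    simp only [Module.End.mul_apply, hπ' v hv] at h2 h3
    simp only [hM, map_mul, map_sub, map_one, map_pow, Module.End.mul_apply,
      LinearMap.sub_apply, Module.End.one_apply, sub_eq_zero] at h1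
    rw [← h2, ← h1, h3]

end ExtendScalars

section Unitary

theorem exists_pow_eq_of_card_eq_mul {G : Type*} [Group G] [IsCyclic G] {a b : ℕ}
    (hb : 0 < b) (hG : Nat.card G = a * b) {x : G} (hx : x ^ b = 1) : ∃ y : G, y ^ a = x := by
  obtain ⟨g, hg⟩ := IsCyclic.exists_generator (α := G)
  obtain ⟨i, rfl⟩ := Subgroup.mem_zpowers_iff.1 (hg x)
  rw [← zpow_natCast, ← _root_.zpow_mul, ← orderOf_dvd_iff_zpow_eq_one,
    orderOf_eq_card_of_forall_mem_zpowers hg, hG, Nat.cast_mul] at hx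
  obtain ⟨c, rfl⟩ := Int.dvd_of_mul_dvd_mul_right (by exact_mod_cast hb.ne') hx
  exact ⟨g ^ c, by rw [← zpow_natCast, ← _root_.zpow_mul, mul_comm]⟩

theorem exists_div_pow_eq {F : Type*} [Field F] [Finite F] {q : ℕ} (hq : 0 < q)
    (hF : Nat.card F = q ^ 2) {x : Fˣ} (hx : x ^ (q + 1) = 1) : ∃ z : Fˣ, x * z ^ q = z := by
  have hcard : Nat.card Fˣ = (q - 1) * (q + 1) := by
    rw [Nat.card_units, hF]
    obtain ⟨k, rfl⟩ : ∃ k, q = k + 1 := ⟨q - 1, by omega⟩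
    rw [Nat.add_sub_cancel, Nat.sub_eq_iff_eq_add (Nat.one_le_pow _ _ hq)]
    ring
  obtain ⟨t, rfl⟩ := exists_pow_eq_of_card_eq_mul (by omega) hcard hx
  refine ⟨t⁻¹, ?_⟩
  obtain ⟨k, rfl⟩ : ∃ k, q = k + 1 := ⟨q - 1, by omega⟩
  rw [Nat.add_sub_cancel, inv_pow, pow_succ, _root_.mul_inv_rev, mul_comm t⁻¹, mul_inv_cancel_left]

/-- The involution `x ↦ x ^ q` of a field with `q ^ 2` elements. -/
abbrev frobeniusStarRing {F : Type*} [Field F] [Fintype F] {p q k : ℕ} [Fact p.Prime] [CharP F p]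
    (hq : q = p ^ k) (hF : Fintype.card F = q ^ 2) : StarRing F where
  star x := x ^ q
  star_involutive x := by
    change (x ^ q) ^ q = x
    rw [← pow_mul, ← sq, ← hF, FiniteField.pow_card]
  star_mul x y := by rw [mul_comm, mul_pow]
  star_add x y := by rw [hq, add_pow_char_pow]

theorem w0Mat_mulVec {F : Type*} [Field F] {n : ℕ} (y : Fin n → F) : w0Mat n F *ᵥ y = fun i => y (Fin.rev i) := by
  ext i
  simp [w0Mat, Matrix.mulVec, dotProduct]

theorem w0Mat_mul_self {F : Type*} [Field F] {n : ℕ} : w0Mat n F * w0Mat n F = 1 := by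
  refine Matrix.toLin'.injective (LinearMap.ext fun y => ?_)
  simp [w0Mat_mulVec]

variable {F : Type*} [Field F] [StarRing F] {n : ℕ}

/-- The hermitian form with Gram matrix `w0Mat`. -/
noncomputable def hermForm (F : Type*) [Field F] [StarRing F] (n : ℕ) :
    (Fin n → F) →ₗ⋆[F] (Fin n → F) →ₗ[F] F :=
  LinearMap.mk₂'ₛₗ (starRingEnd F) (RingHom.id F) (fun x y => ∑ i, star (x i) * y (Fin.rev i))
    (by simp [add_mul, Finset.sum_add_distrib])
    (by simp [Finset.mul_sum, mul_assoc, starRingEnd_apply])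
    (by simp [mul_add, Finset.sum_add_distrib])
    (by simp [Finset.mul_sum, mul_left_comm])

theorem hermForm_apply (x y : Fin n → F) :
    hermForm F n x y = ∑ i, star (x i) * y (Fin.rev i) := rfl

theorem hermForm_eq_dotProduct (x y : Fin n → F) :
    hermForm F n x y = star x ⬝ᵥ w0Mat n F *ᵥ y := by
  rw [w0Mat_mulVec]; rfl

theorem hermForm_symm (x y : Fin n → F) : hermForm F n x y = star (hermForm F n y x) := by
  simp only [hermForm_apply, star_sum, star_mul, star_star]
  exact Fintype.sum_equiv Fin.revPerm _ _ fun i => by simp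

theorem hermForm_nondegenerate (y : Fin n → F) (h : ∀ x, hermForm F n x y = 0) : y = 0 := by
  ext i
  have := h (Pi.single (Fin.rev i) 1)
  rw [hermForm_apply, Finset.sum_eq_single (Fin.rev i)] at this
  · simpa using this
  · intro j _ hj
    simp [hj]
  · simp

theorem isometry_iff (g : GL (Fin n) F) :
    (∀ x y, hermForm F n (Matrix.toLin' (g : Matrix (Fin n) (Fin n) F) x)
      (Matrix.toLin' (g : Matrix (Fin n) (Fin n) F) y) = hermForm F n x y) ↔
    w0Mat n F * ((g : Matrix (Fin n) (Fin n) F)ᴴ)⁻¹ * w0Mat n F = g := by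
  set A := (g : Matrix (Fin n) (Fin n) F) with hA
  have hdet : IsUnit Aᴴ.det := by
    rw [Matrix.det_conjTranspose]
    exact ((Matrix.isUnit_iff_isUnit_det A).1 g.isUnit).star
  have h1 : ∀ x y, hermForm F n (Matrix.toLin' A x) (Matrix.toLin' A y) =
      star x ⬝ᵥ (Aᴴ * w0Mat n F * A) *ᵥ y := by
    intro x y
    rw [hermForm_eq_dotProduct, Matrix.toLin'_apply, Matrix.toLin'_apply, Matrix.star_mulVec,
      ← Matrix.dotProduct_mulVec, Matrix.mulVec_mulVec, Matrix.mulVec_mulVec, Matrix.mul_assoc]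
  have h2 : (∀ x y, hermForm F n (Matrix.toLin' A x) (Matrix.toLin' A y) = hermForm F n x y) ↔
      Aᴴ * w0Mat n F * A = w0Mat n F := by
    simp only [h1, hermForm_eq_dotProduct]
    refine ⟨fun h => ?_, fun h x y => by rw [h]⟩
    refine Matrix.toLin'.injective (LinearMap.ext fun y => ?_)
    refine dotProduct_eq _ _ fun x => ?_
    have := h (star x) y
    rwa [star_star, dotProduct_comm, dotProduct_comm x] at this
  rw [h2]
  constructor
  · intro h
    have h3 := congrArg ((Aᴴ)⁻¹ * ·) h
    simp only [Matrix.mul_assoc, Matrix.nonsing_inv_mul_cancel_left _ _ hdet] at h3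
    rw [Matrix.mul_assoc, ← h3, ← Matrix.mul_assoc, w0Mat_mul_self, Matrix.one_mul]
  · intro h
    have h3 := congrArg (w0Mat n F * ·) h
    simp only [← Matrix.mul_assoc, w0Mat_mul_self, Matrix.one_mul] at h3
    rw [Matrix.mul_assoc, ← h3, Matrix.mul_nonsing_inv_cancel_left _ _ hdet]

/-- The isometry group of `hermForm`. -/
def isometryGroup (F : Type*) [Field F] [StarRing F] (n : ℕ) : Subgroup (GL (Fin n) F) where
  carrier := {g | ∀ x y, hermForm F n (Matrix.toLin' (g : Matrix (Fin n) (Fin n) F) x)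
    (Matrix.toLin' (g : Matrix (Fin n) (Fin n) F) y) = hermForm F n x y}
  mul_mem' := fun ha hb x y => by
    simp only [Units.val_mul, Matrix.toLin'_mul, LinearMap.comp_apply]
    rw [ha, hb]
  one_mem' := by simp
  inv_mem' := fun {g} hg x y => by
    have h : ∀ x, Matrix.toLin' (g : Matrix (Fin n) (Fin n) F)
        (Matrix.toLin' ((g⁻¹ : GL (Fin n) F) : Matrix (Fin n) (Fin n) F) x) = x := by
      intro x
      rw [← LinearMap.comp_apply, ← Matrix.toLin'_mul, ← Units.val_mul, mul_inv_cancel]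
      simp
    rw [← hg, h, h]

end Unitary

theorem commute_of_commute_mul {G : Type*} [Group G] {s u g : G} (hsu : Commute s u)
    (hco : (orderOf s).Coprime (orderOf u)) (hg : Commute g (s * u)) : Commute g u := by
  obtain ⟨m, hm⟩ := exists_pow_eq_self_of_coprime hco
  have h := (hg.pow_right (orderOf s)).pow_right m
  rwa [hsu.mul_pow, pow_orderOf_eq_one, one_mul, hm] at h

theorem orderOf_dvd_pow_of_isNilpotent_sub_one {F : Type*} [Field F] {p n : ℕ} [Fact p.Prime]
    [CharP F p] [Nonempty (Fin n)] {u : GL (Fin n) F}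
    (hu : IsNilpotent ((u : Matrix (Fin n) (Fin n) F) - 1)) : ∃ e, orderOf u ∣ p ^ e := by
  obtain ⟨e, he⟩ := hu
  refine ⟨e, orderOf_dvd_of_pow_eq_one (Units.ext ?_)⟩
  have h := sub_pow_char_pow_of_commute p e (Commute.one_right (u : Matrix (Fin n) (Fin n) F))
  rw [pow_eq_zero_of_le (Nat.lt_pow_self (Fact.out : p.Prime).one_lt).le he, one_pow] at h
  rw [Units.val_pow_eq_pow_val, Units.val_one]
  exact (sub_eq_zero.1 h.symm)

theorem toLin'_coe_pow {F : Type*} [Field F] {n : ℕ} (g : GL (Fin n) F) (k : ℕ) :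
    (Matrix.toLin' (g : Matrix (Fin n) (Fin n) F)) ^ k =
      Matrix.toLin' ((g ^ k : GL (Fin n) F) : Matrix (Fin n) (Fin n) F) := by
  rw [Units.val_pow_eq_pow_val, Matrix.toLin'_pow]

theorem toLin'_coe_pow_orderOf {F : Type*} [Field F] {n : ℕ} (g : GL (Fin n) F) :
    (Matrix.toLin' (g : Matrix (Fin n) (Fin n) F)) ^ orderOf g = 1 := by
  rw [toLin'_coe_pow, pow_orderOf_eq_one, Units.val_one, Matrix.toLin'_one]; rfl

theorem commute_toLin'_iff {F : Type*} [Field F] {n : ℕ} {A B : Matrix (Fin n) (Fin n) F} :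
    Commute (Matrix.toLin' A) (Matrix.toLin' B) ↔ Commute A B := by
  rw [commute_iff_eq, commute_iff_eq, Module.End.mul_eq_comp, Module.End.mul_eq_comp,
    ← Matrix.toLin'_mul, ← Matrix.toLin'_mul, Matrix.toLin'.injective.eq_iff]

theorem Commute.toLin'_coe {F : Type*} [Field F] {n : ℕ} {g k : GL (Fin n) F} (h : Commute g k) :
    Commute (Matrix.toLin' (g : Matrix (Fin n) (Fin n) F))
      (Matrix.toLin' (k : Matrix (Fin n) (Fin n) F)) :=
  commute_toLin'_iff.2 (congrArg Units.val h)

section Centralizer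

variable {F : Type*} [Field F] [Finite F] [StarRing F] {n : ℕ} {s u : GL (Fin n) F}

theorem exists_det_eq_pow_of_mem_isometryGroup (hu : u ∈ isometryGroup F n)
    (hnil : IsNilpotent ((u : Matrix (Fin n) (Fin n) F) - 1)) {g : GL (Fin n) F}
    (hg : g ∈ isometryGroup F n) (hgu : Commute g u) {d : ℕ} (hd0 : 0 < d)
    (hd : ∀ j, ¬ d ∣ j + 1 → ∀ v,
      ((Matrix.toLin' (u : Matrix (Fin n) (Fin n) F) - 1) ^ (j + 1)) v = 0 →
      ((Matrix.toLin' (u : Matrix (Fin n) (Fin n) F) - 1) ^ j) v ∈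
        LinearMap.range ((Matrix.toLin' (u : Matrix (Fin n) (Fin n) F) - 1) ^ (j + 1))) :
    ∃ δ : F, star δ * δ = 1 ∧ (g : Matrix (Fin n) (Fin n) F).det = δ ^ d := by
  obtain ⟨m, hm⟩ := Nat.exists_eq_add_one.2 (orderOf_pos u)
  have hum := toLin'_coe_pow_orderOf u
  rw [hm] at hum
  set U := Matrix.toLin' (u : Matrix (Fin n) (Fin n) F) with hU
  have hN : ∀ x y, hermForm F n ((U - 1) x) y = hermForm F n x ((U ^ m - 1) y) := by
    intro x y
    have h : hermForm F n (U x) y = hermForm F n x ((U ^ m) y) := by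
      rw [← hu x, ← hU, ← Module.End.mul_apply U, ← pow_succ', hum, Module.End.one_apply]
    simp [h]
  have hU1 : U - 1 = Matrix.toLin' ((u : Matrix (Fin n) (Fin n) F) - 1) := by
    rw [map_sub, Matrix.toLin'_one]; rfl
  obtain ⟨δ, h1, h2⟩ := exists_det_eq_pow hermForm_nondegenerate hN
    (fun j t => pow_sub_one_pow_apply_eq_zero_iff hum)
    (by
      obtain ⟨k, hk⟩ := hnil
      exact ⟨k, by rw [hU1, ← Matrix.toLin'_pow, hk, map_zero]⟩)
    hg (hgu.toLin'_coe.sub_right (Commute.one_right _)) hd0 hd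
  exact ⟨δ, h1, by rw [← h2, LinearMap.det_toLin']⟩

theorem exists_mem_isometryGroup_det (hsu : Commute s u) (hs : s ∈ isometryGroup F n)
    (hu : u ∈ isometryGroup F n) {f g : Polynomial F} (hf : Irreducible f) (hfm : f.Monic)
    (hfg : Polynomial.X ^ orderOf s - 1 = f * g) (hco : IsCoprime f g) {v : Fin n → F}
    (hv : Polynomial.aeval (Matrix.toLin' (s : Matrix (Fin n) (Fin n) F)) f v = 0) {k : ℕ}
    (hk : ((Matrix.toLin' (u : Matrix (Fin n) (Fin n) F) - 1) ^ (k + 1)) v = 0)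
    (hk' : ((Matrix.toLin' (u : Matrix (Fin n) (Fin n) F) - 1) ^ k) v ∉
        LinearMap.range ((Matrix.toLin' (u : Matrix (Fin n) (Fin n) F) - 1) ^ (k + 1)))
    (hstar : ∃ c : F, star c ≠ c) {y z : F} (hz : z ≠ 0) (hyz : y * star z = z) :
    ∃ x ∈ isometryGroup F n, Commute x (s * u) ∧
      (x : Matrix (Fin n) (Fin n) F).det = y ^ (k + 1) := by
  obtain ⟨m, hm⟩ := Nat.exists_eq_add_one.2 (orderOf_pos u)
  obtain ⟨r, hr⟩ := Nat.exists_eq_add_one.2 (orderOf_pos s)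
  have hum := toLin'_coe_pow_orderOf u
  have hsr := toLin'_coe_pow_orderOf s
  rw [hm] at hum
  rw [hr] at hsr hfg
  obtain ⟨x, hx, hxc, hdet⟩ := exists_isometry_of_jordanBlock hermForm_symm hermForm_nondegenerate
    hsu.toLin'_coe hs hu hsr hum hf hfm hfg hco hv hk hk' hstar hz
  have hzk : star (z ^ (k + 1)) ≠ 0 := star_ne_zero.2 (pow_ne_zero _ hz)
  have hxd : LinearMap.det x = y ^ (k + 1) := by
    refine mul_right_cancel₀ hzk ?_
    rw [hdet, star_pow, ← mul_pow, hyz]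
  have hy : y ≠ 0 := by
    rintro rfl
    exact hz (by rw [← hyz, zero_mul])
  have hM : (LinearMap.toMatrix' x).det = y ^ (k + 1) := by rw [LinearMap.det_toMatrix', hxd]
  refine ⟨Matrix.GeneralLinearGroup.mkOfDetNeZero (LinearMap.toMatrix' x)
    (by rw [hM]; exact pow_ne_zero _ hy), ?_, ?_, hM⟩
  · intro v w
    change hermForm F n (Matrix.toLin' (LinearMap.toMatrix' x) v)
      (Matrix.toLin' (LinearMap.toMatrix' x) w) = _
    rw [Matrix.toLin'_toMatrix', hx]
  · refine Units.ext ?_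
    refine commute_toLin'_iff.1 ?_
    change Commute (Matrix.toLin' (LinearMap.toMatrix' x)) _
    rw [Matrix.toLin'_toMatrix', Units.val_mul, Matrix.toLin'_mul]
    exact hxc

end Centralizer

theorem mem_isometryGroup_iff_isGU {F : Type*} [Field F] [Fintype F] [StarRing F] {q n : ℕ}
    (hstar : ∀ x : F, star x = x ^ q) (g : GL (Fin n) F) : g ∈ isometryGroup F n ↔ IsGU q g := by
  have h : (g : Matrix (Fin n) (Fin n) F)ᴴ = ((g : Matrix (Fin n) (Fin n) F).map (· ^ q))ᵀ := by
    ext i j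
    simp [hstar]
  rw [IsGU, ← h]
  exact isometry_iff g

theorem exists_pow_ne_self {F : Type*} [Field F] [Fintype F] {q : ℕ} (hq : 1 < q)
    (hF : Fintype.card F = q ^ 2) : ∃ c : F, c ^ q ≠ c := by
  by_contra! h
  have hne := FiniteField.X_pow_card_sub_X_ne_zero F hq
  have hle := Polynomial.card_le_degree_of_subset_roots (p := Polynomial.X ^ q - Polynomial.X)
    (Z := (Finset.univ : Finset F)) fun c _ => by
      rw [Polynomial.mem_roots hne]
      simp [h c]
  rw [FiniteField.X_pow_card_sub_X_natDegree_eq F hq, Finset.card_univ, hF] at hle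
  nlinarith

/-- In an abelian group, `y ^ d` lies in `H` once `d` is a common multiple of the divisors of
all the exponents of powers of `y` lying in `H`. -/
theorem pow_mem_of_forall_dvd {G : Type*} [CommGroup G] (H : Subgroup G) {y : G} {d : ℕ}
    (h : ∀ t : ℕ, (∀ i, y ^ i ∈ H → t ∣ i) → t ∣ d) : y ^ d ∈ H := by
  rw [← QuotientGroup.eq_one_iff, QuotientGroup.mk_pow, ← orderOf_dvd_iff_pow_eq_one]
  refine h _ fun i hi => orderOf_dvd_of_pow_eq_one ?_
  rwa [← QuotientGroup.mk_pow, QuotientGroup.eq_one_iff]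

theorem extendScalars_toLin'_sub_one {F K : Type*} [Field F] [Field K] [Algebra F K] {n : ℕ}
    (u : GL (Fin n) F) : extendScalars F K (Fin n)
      (Matrix.toLin' (u : Matrix (Fin n) (Fin n) F) - 1) = glToEnd u - 1 := by
  rw [map_sub, extendScalars_toLin', map_one, glToEnd]

theorem commute_glToEnd {F K : Type*} [Field F] [Field K] [Algebra F K] {n : ℕ}
    {s u : GL (Fin n) F} (h : Commute s u) :
    Commute (glToEnd (K := K) s) (glToEnd (K := K) u - 1) := by
  rw [← extendScalars_toLin'_sub_one, glToEnd, ← extendScalars_toLin']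
  exact (h.toLin'_coe.sub_right (Commute.one_right _)).map (extendScalars F K (Fin n))

/-- key determinant computation in Proposition 4.6 of the paper.
Let `s, u ∈ GU_n(q)` be commuting, `s` of order coprime to `p` (semisimple) and `u`
unipotent.  For each eigenvalue `ξ` of `s` over an algebraic closure `K`, let `Λ ξ` be the
Jordan type of the restriction of `u` to `ker (s - ξ)`.  Let `d` be the gcd of `q + 1` and all
parts of all `Λ ξ`.  Then the image under the determinant of the centralizer of `su` in
`GU_n(q)` equals the unique subgroup of index `d` of `μ_{q+1}`, namely
`{x ∈ 𝔽_{q²}^× : x^{(q+1)/d} = 1}`. -/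
theorem stmt12 {p q : ℕ} (hp : p.Prime) (k₀ : ℕ) (hk₀ : 0 < k₀) (hq : q = p ^ k₀)
    {n : ℕ} (hn : 2 ≤ n)
    (F2 : Type*) [Field F2] [Fintype F2] (hcard : Fintype.card F2 = q ^ 2)
    (K : Type*) [Field K] [IsAlgClosed K] [Algebra F2 K]
    (s u : GL (Fin n) F2)
    (hsGU : IsGU q s) (huGU : IsGU q u)
    (hsu : s * u = u * s)
    (hs : Nat.Coprime (orderOf s) p)
    (hu : IsNilpotent ((u : Matrix (Fin n) (Fin n) F2) - 1))
    (Λ : K → Multiset ℕ)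
    (hΛpos : ∀ ξ : K, (glToEnd (K := K) s).HasEigenvalue ξ → ∀ i ∈ Λ ξ, 0 < i)
    (hΛsum : ∀ ξ : K, (glToEnd (K := K) s).HasEigenvalue ξ →
      (Λ ξ).sum = finrank K ((glToEnd (K := K) s).eigenspace ξ))
    (hΛrank : ∀ ξ : K, (glToEnd (K := K) s).HasEigenvalue ξ → ∀ k : ℕ, 1 ≤ k →
      ((Λ ξ).filter (fun i => k ≤ i)).card =
        finrank K (((glToEnd (K := K) s).eigenspace ξ).map ((glToEnd (K := K) u - 1) ^ (k - 1)))
          - finrank K (((glToEnd (K := K) s).eigenspace ξ).map ((glToEnd (K := K) u - 1) ^ k)))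
    (d : ℕ)
    (hd : ∀ t : ℕ, t ∣ d ↔ (t ∣ q + 1 ∧
      ∀ ξ : K, (glToEnd (K := K) s).HasEigenvalue ξ → ∀ i ∈ Λ ξ, t ∣ i)) :
    (fun g : GL (Fin n) F2 => (g : Matrix (Fin n) (Fin n) F2).det) ''
        {g : GL (Fin n) F2 | IsGU q g ∧ g * (s * u) = (s * u) * g}
      = {x : F2 | x ^ ((q + 1) / d) = 1} := by
  have : Fact p.Prime := ⟨hp⟩
  have : CharP F2 p := charP_of_card_eq_prime_pow (f := k₀ * 2) (by rw [hcard, hq, ← pow_mul])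
  have : Nonempty (Fin n) := ⟨⟨0, by omega⟩⟩
  let _ := frobeniusStarRing hq hcard
  have hstar : ∀ x : F2, star x = x ^ q := fun _ => rfl
  have hq1 : 1 < q := hq ▸ Nat.one_lt_pow hk₀.ne' hp.one_lt
  rw [← mem_isometryGroup_iff_isGU hstar] at hsGU huGU
  obtain ⟨hdq, hdΛ⟩ := (hd d).1 dvd_rfl
  have hd0 : 0 < d := Nat.pos_of_dvd_of_pos hdq q.succ_pos
  have hr0 : (orderOf s : F2) ≠ 0 := by
    rw [Ne, CharP.cast_eq_zero_iff F2 p]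
    exact fun h => hp.one_lt.ne' (Nat.eq_one_of_dvd_coprimes hs h dvd_rfl)
  have hsr := toLin'_coe_pow_orderOf s
  have hsN : Commute (Matrix.toLin' (s : Matrix (Fin n) (Fin n) F2))
      (Matrix.toLin' (u : Matrix (Fin n) (Fin n) F2) - 1) :=
    (Commute.toLin'_coe hsu).sub_right (Commute.one_right _)
  have hΛ : ∀ ξ : K, (glToEnd (K := K) s).HasEigenvalue ξ → ∀ k, k + 1 ∈ Λ ξ ↔
      ∃ v ∈ (glToEnd (K := K) s).eigenspace ξ, ((glToEnd (K := K) u - 1) ^ (k + 1)) v = 0 ∧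
        ((glToEnd (K := K) u - 1) ^ k) v ∉
          ((glToEnd (K := K) s).eigenspace ξ).map ((glToEnd (K := K) u - 1) ^ (k + 1)) :=
    fun ξ hξ => mem_jordanType_iff
      (fun x hx => Module.End.mapsTo_genEigenspace_of_comm (commute_glToEnd hsu) ξ 1 hx)
      (hΛrank ξ hξ)
  ext x
  constructor
  · rintro ⟨g, ⟨hgGU, hgc⟩, rfl⟩
    rw [← mem_isometryGroup_iff_isGU hstar] at hgGU
    obtain ⟨e, he⟩ := orderOf_dvd_pow_of_isNilpotent_sub_one hu
    have hgu : Commute g u := commute_of_commute_mul hsu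
      ((hs.pow_right e).coprime_dvd_right he) hgc
    obtain ⟨δ, hδ, hdet⟩ := exists_det_eq_pow_of_mem_isometryGroup huGU hu hgGU hgu hd0
      fun j hj v hv => by
        refine pow_apply_mem_range_of_eigenspace (K := K) hr0 hsr hsN ?_ hv
        rw [extendScalars_toLin'_sub_one, extendScalars_toLin']
        intro ξ hξ w hw hw0
        by_contra hw1
        exact hj (hdΛ ξ hξ _ ((hΛ ξ hξ j).2
          ⟨w, hw, hw0, fun h => hw1 (LinearMap.map_le_range h)⟩))
    change (g : Matrix (Fin n) (Fin n) F2).det ^ _ = 1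
    rw [hdet, ← pow_mul, Nat.mul_div_cancel' hdq, pow_succ, ← hstar, hδ]
  · intro hx
    change x ^ _ = 1 at hx
    have hb : 0 < (q + 1) / d := Nat.div_pos (Nat.le_of_dvd q.succ_pos hdq) hd0
    have hx0 : x ≠ 0 := by
      rintro rfl
      simp [hb.ne'] at hx
    have hcardU : Nat.card F2ˣ = (q - 1) * (q + 1) := by
      rw [Nat.card_units, Nat.card_eq_fintype_card, hcard, mul_comm]
      exact Nat.sq_sub_sq q 1
    obtain ⟨t, ht⟩ := exists_pow_eq_of_card_eq_mul (x := Units.mk0 x hx0) (a := (q - 1) * d) hb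
      (by rw [hcardU, mul_assoc, Nat.mul_div_cancel' hdq]) (Units.ext (by simpa using hx))
    have hy : (t ^ (q - 1)) ^ (q + 1) = 1 := by rw [← pow_mul, ← hcardU, pow_card_eq_one']
    obtain ⟨z, hz⟩ := exists_div_pow_eq (by omega) (Nat.card_eq_fintype_card.trans hcard) hy
    have hmem : (t ^ (q - 1)) ^ d ∈ (isometryGroup F2 n ⊓ Subgroup.centralizer {s * u}).map
        Matrix.GeneralLinearGroup.det := by
      refine pow_mem_of_forall_dvd _ fun m hm => (hd m).2 ⟨hm _ (hy ▸ one_mem _), ?_⟩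
      intro ξ hξ i hi
      refine hm i ?_
      obtain ⟨k, rfl⟩ := Nat.exists_eq_add_one.2 (hΛpos ξ hξ i hi)
      obtain ⟨v, hv, hk, hk'⟩ := (hΛ ξ hξ k).1 hi
      rw [← extendScalars_toLin'_sub_one] at hk hk'
      rw [glToEnd, ← extendScalars_toLin'] at hξ hv hk'
      obtain ⟨f, g, hf, hfm, hfg, hco, w, hw, hwk, hwk'⟩ :=
        exists_pow_apply_notMem_range hr0 hsr hsN hξ hv hk hk'
      obtain ⟨X, hX, hXc, hdet⟩ := exists_mem_isometryGroup_det hsu hsGU huGU hf hfm hfg hco hw hwk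
        hwk' (exists_pow_ne_self hq1 hcard) z.ne_zero (congrArg Units.val hz)
      exact ⟨X, ⟨hX, Subgroup.mem_centralizer_singleton_iff.2 hXc⟩, Units.ext hdet⟩
    obtain ⟨X, ⟨hX, hXc⟩, hdet⟩ := hmem
    refine ⟨X, ⟨(mem_isometryGroup_iff_isGU hstar X).1 hX,
      Subgroup.mem_centralizer_singleton_iff.1 hXc⟩, ?_⟩
    rw [← pow_mul, ht] at hdet
    exact congrArg Units.val hdet
end
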